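/- arXiv:math/0505138 — 5 statements merged into one kernel-verified Lean document; each statement's English description precedes it below -/
import Mathlib

section
/- Let k be an algebraically closed field of characteristic 2. The six substitutions λ ↦ λ, λ ↦ λ+1, λ ↦ 1/λ, λ ↦ 1/(λ+1), λ ↦ λ/(λ+1), λ ↦ (λ+1)/λ form a group Γ_A of order 6 of k-algebra automorphisms of the ring R = k[λ, 1/(λ(λ+1))], and the ring of Γ_A-invariants R^{Γ_A} is equal to the polynomial subring k[J_A], where J_A = (λ²+λ+1)³/(λ²(λ+1)²). -/
section Orbit

variable {K : Type*} [Field K]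

/-- The orbit of `x` under the anharmonic group, written in characteristic two. -/
def anharmonicOrbit (x : K) : Set K :=
  {x, x + 1, x⁻¹, (x + 1)⁻¹, x / (x + 1), (x + 1) / x}

/-- The `j`-invariant of the Legendre-type parameter `x` in characteristic two. -/
def anharmonicInvariant (x : K) : K :=
  (x ^ 2 + x + 1) ^ 3 / (x ^ 2 * (x + 1) ^ 2)

lemma mem_anharmonicOrbit {x y : K} : y ∈ anharmonicOrbit x ↔
    y = x ∨ y = x + 1 ∨ y = x⁻¹ ∨ y = (x + 1)⁻¹ ∨ y = x / (x + 1) ∨ y = (x + 1) / x :=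
  Iff.rfl

lemma self_mem_anharmonicOrbit (x : K) : x ∈ anharmonicOrbit x := Or.inl rfl

lemma div_add_one_eq {x : K} (hx : x ≠ 0) : x / (x + 1) = (x⁻¹ + 1)⁻¹ := by
  rw [show x⁻¹ + 1 = (x + 1) / x by field_simp; ring, inv_div]

lemma add_one_div_eq {x : K} (hx : x ≠ 0) : (x + 1) / x = x⁻¹ + 1 := by
  field_simp; ring

lemma ne_zero_of_mem_anharmonicOrbit {x y : K} (hx : x ≠ 0) (hx1 : x + 1 ≠ 0)
    (h : y ∈ anharmonicOrbit x) : y ≠ 0 := by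
  rcases mem_anharmonicOrbit.1 h with rfl | rfl | rfl | rfl | rfl | rfl <;> simp [hx, hx1]

lemma inv_mem_anharmonicOrbit {x y : K} (h : y ∈ anharmonicOrbit x) :
    y⁻¹ ∈ anharmonicOrbit x := by
  rw [mem_anharmonicOrbit] at h ⊢
  rcases h with rfl | rfl | rfl | rfl | rfl | rfl <;> simp

lemma anharmonicInvariant_inv {x : K} (hx : x ≠ 0) (hx1 : x + 1 ≠ 0) :
    anharmonicInvariant x⁻¹ = anharmonicInvariant x := by
  have h : x⁻¹ + 1 = (x + 1) / x := (add_one_div_eq hx).symm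
  have h' : x⁻¹ ^ 2 + x⁻¹ + 1 = (x ^ 2 + x + 1) / x ^ 2 := by field_simp; ring
  rw [anharmonicInvariant, anharmonicInvariant, h', h]
  field_simp

lemma IntermediateField.anharmonicOrbit_subset {F : Type*} [Field F] [Algebra F K]
    (E : IntermediateField F K) {x : K} (hx : x ∈ E) : anharmonicOrbit x ⊆ E := by
  intro y hy
  have hx1 := E.add_mem hx E.one_mem
  rcases mem_anharmonicOrbit.1 hy with rfl | rfl | rfl | rfl | rfl | rfl
  · exact hx
  · exact hx1
  · exact E.inv_mem hx
  · exact E.inv_mem hx1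
  · exact E.div_mem hx hx1
  · exact E.div_mem hx1 hx

section CharTwo

variable [CharP K 2]

lemma add_one_mem_anharmonicOrbit {x y : K} (hx : x ≠ 0) (hx1 : x + 1 ≠ 0)
    (h : y ∈ anharmonicOrbit x) : y + 1 ∈ anharmonicOrbit x := by
  have h2 : (2 : K) = 0 := CharTwo.two_eq_zero
  rw [mem_anharmonicOrbit] at h ⊢
  rcases h with rfl | rfl | rfl | rfl | rfl | rfl
  · simp
  · left; linear_combination h2
  · right; right; right; right; right; field_simp; ring
  · right; right; right; right; left; field_simp; linear_combination h2
  · right; right; right; left; field_simp; linear_combination x * h2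
  · right; right; left; field_simp; linear_combination x * h2

lemma anharmonicOrbit_subset {x y : K} (hx : x ≠ 0) (hx1 : x + 1 ≠ 0)
    (h : y ∈ anharmonicOrbit x) : anharmonicOrbit y ⊆ anharmonicOrbit x := by
  intro z hz
  have hy := ne_zero_of_mem_anharmonicOrbit hx hx1 h
  have hadd {w : K} := add_one_mem_anharmonicOrbit (y := w) hx hx1
  have hinv {w : K} := inv_mem_anharmonicOrbit (x := x) (y := w)
  rcases mem_anharmonicOrbit.1 hz with rfl | rfl | rfl | rfl | rfl | rfl
  · exact h
  · exact hadd h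
  · exact hinv h
  · exact hinv (hadd h)
  · rw [div_add_one_eq hy]; exact hinv (hadd (hinv h))
  · rw [add_one_div_eq hy]; exact hadd (hinv h)

lemma mem_anharmonicOrbit_symm {x y : K} (hx : x ≠ 0) (hx1 : x + 1 ≠ 0)
    (h : y ∈ anharmonicOrbit x) : x ∈ anharmonicOrbit y := by
  have h2 : (2 : K) = 0 := CharTwo.two_eq_zero
  rw [mem_anharmonicOrbit] at h ⊢
  rcases h with rfl | rfl | rfl | rfl | rfl | rfl
  · simp
  · right; left; linear_combination -h2
  · simp
  · right; right; right; right; right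
    rw [add_one_div_eq (inv_ne_zero hx1), inv_inv]; linear_combination -h2
  · right; right; right; right; left
    rw [div_add_one_eq (div_ne_zero hx hx1), inv_div, eq_comm, inv_eq_iff_eq_inv]
    field_simp; linear_combination x * h2
  · right; right; right; left
    rw [eq_comm, inv_eq_iff_eq_inv]; field_simp; linear_combination x * h2

lemma anharmonicInvariant_add_one (x : K) :
    anharmonicInvariant (x + 1) = anharmonicInvariant x := by
  have h2 : (2 : K) = 0 := CharTwo.two_eq_zero
  have h : x + 1 + 1 = x := by linear_combination h2
  have h' : (x + 1) ^ 2 + (x + 1) + 1 = x ^ 2 + x + 1 := by linear_combination (x + 1) * h2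
  rw [anharmonicInvariant, anharmonicInvariant, h', h, mul_comm ((x + 1) ^ 2)]

lemma anharmonicInvariant_eq_of_mem {x y : K} (hx : x ≠ 0) (hx1 : x + 1 ≠ 0)
    (h : y ∈ anharmonicOrbit x) : anharmonicInvariant y = anharmonicInvariant x := by
  have h2 : (2 : K) = 0 := CharTwo.two_eq_zero
  have hinv := anharmonicInvariant_inv hx hx1
  have hx' : x⁻¹ + 1 ≠ 0 := by rw [← add_one_div_eq hx]; exact div_ne_zero hx1 hx
  rcases mem_anharmonicOrbit.1 h with rfl | rfl | rfl | rfl | rfl | rfl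
  · rfl
  · exact anharmonicInvariant_add_one x
  · exact hinv
  · rw [anharmonicInvariant_inv hx1, anharmonicInvariant_add_one]
    rwa [show x + 1 + 1 = x by linear_combination h2]
  · rw [div_add_one_eq hx, anharmonicInvariant_inv hx', anharmonicInvariant_add_one, hinv]
    rw [show x⁻¹ + 1 + 1 = x⁻¹ by linear_combination h2]
    exact inv_ne_zero hx
  · rw [add_one_div_eq hx, anharmonicInvariant_add_one, hinv]

lemma ncard_anharmonicOrbit {x : K} (hx : x ≠ 0) (hx1 : x + 1 ≠ 0) (hx2 : x ^ 2 + x + 1 ≠ 0) :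
    (anharmonicOrbit x).ncard = 6 := by
  classical
  have h2 : (2 : K) = 0 := CharTwo.two_eq_zero
  have h11 : (x + 1) ^ 2 ≠ 0 := pow_ne_zero 2 hx1
  have h00 : x ^ 2 ≠ 0 := pow_ne_zero 2 hx
  have key : (anharmonicOrbit x) =
      (({x, x + 1, x⁻¹, (x + 1)⁻¹, x / (x + 1), (x + 1) / x} : Finset K) : Set K) := by
    simp [anharmonicOrbit]
  rw [key, Set.ncard_coe_finset]
  have e1 : x ≠ x + 1 := by simp
  have e2 : x ≠ x⁻¹ := fun h ↦ h11 (by field_simp at h; linear_combination h + (x + 1) * h2)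
  have e3 : x ≠ (x + 1)⁻¹ := fun h ↦ hx2 (by field_simp at h; linear_combination h + h2)
  have e4 : x ≠ x / (x + 1) := fun h ↦ h00 (by
    rw [eq_div_iff hx1] at h; linear_combination h)
  have e5 : x ≠ (x + 1) / x := fun h ↦ hx2 (by
    rw [eq_div_iff hx] at h; linear_combination h + (x + 1) * h2)
  have e6 : x + 1 ≠ x⁻¹ := fun h ↦ hx2 (by field_simp at h; linear_combination h + h2)
  have e7 : x + 1 ≠ (x + 1)⁻¹ := fun h ↦ h00 (by
    rw [← mul_eq_one_iff_eq_inv₀ hx1] at h; linear_combination h - x * h2)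
  have e8 : x + 1 ≠ x / (x + 1) := fun h ↦ hx2 (by
    rw [eq_div_iff hx1] at h; linear_combination h)
  have e9 : x + 1 ≠ (x + 1) / x := fun h ↦ h11 (by
    rw [eq_div_iff hx] at h; linear_combination h + (x + 1) * h2)
  have e10 : x⁻¹ ≠ (x + 1)⁻¹ := fun h ↦ e1 (inv_injective h)
  have e11 : x⁻¹ ≠ x / (x + 1) := fun h ↦ e5 (by rw [← inv_div, ← h, inv_inv])
  have e12 : x⁻¹ ≠ (x + 1) / x := fun h ↦ e4 (by rw [← inv_div, ← h, inv_inv])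
  have e13 : (x + 1)⁻¹ ≠ x / (x + 1) := fun h ↦ e9 (by rw [← inv_div, ← h, inv_inv])
  have e14 : (x + 1)⁻¹ ≠ (x + 1) / x := fun h ↦ e8 (by rw [← inv_div, ← h, inv_inv])
  have e15 : x / (x + 1) ≠ (x + 1) / x := fun h ↦ one_ne_zero (α := K) (by
    rw [div_eq_div_iff hx1 hx] at h; linear_combination - h - x * h2)
  rw [Finset.card_insert_of_notMem, Finset.card_insert_of_notMem, Finset.card_insert_of_notMem,
    Finset.card_insert_of_notMem, Finset.card_insert_of_notMem, Finset.card_singleton]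
  all_goals
    simp only [Finset.mem_insert, Finset.mem_singleton, not_or]
    tauto

end CharTwo

end Orbit

section Polynomial

open Polynomial

variable {k : Type*} [Field k] [CharP k 2]

lemma Polynomial.exists_eq_X_mul_X_add_one_mul {P : k[X]} (hP : P.comp (X + 1) = P)
    (h0 : P.eval 0 = 0) : ∃ Q : k[X], P = X * (X + 1) * Q := by
  have h1 : P.eval 1 = 0 := by
    have := congrArg (eval 0) hP
    simpa [eval_comp, h0] using this
  obtain ⟨A, rfl⟩ := (X_dvd_iff (f := P)).2 (by rwa [coeff_zero_eq_eval_zero])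
  have hA : A.IsRoot 1 := by simpa using h1
  obtain ⟨Q, rfl⟩ := dvd_iff_isRoot.2 hA
  refine ⟨Q, ?_⟩
  have h2 : (2 : k[X]) = 0 := CharTwo.two_eq_zero
  rw [C_1]
  linear_combination (-X * Q) * h2

lemma Polynomial.even_natDegree_of_comp_X_add_one {P : k[X]} (hP : P.comp (X + 1) = P) :
    Even P.natDegree := by
  rcases Nat.eq_zero_or_pos P.natDegree with h | hpos
  · simp [h]
  obtain ⟨m, hm⟩ := Nat.exists_eq_add_of_lt hpos
  rw [zero_add] at hm
  have hne : P ≠ 0 := by rintro rfl; simp at hpos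
  have h : (taylor 1 P).coeff m = P.coeff m := by rw [taylor_apply, C_1, hP]
  have hdeg : (hasseDeriv m P).natDegree < 2 := by
    have := natDegree_hasseDeriv_le P m
    lia
  rw [taylor_coeff, eval_eq_sum_range' hdeg] at h
  simp only [Finset.sum_range_succ, Finset.sum_range_zero, hasseDeriv_coeff, one_pow, mul_one,
    zero_add, Nat.choose_self, Nat.cast_one, one_mul, add_eq_left, mul_eq_zero] at h
  rcases h with h | h
  · rw [add_comm 1 m, Nat.choose_succ_self_right, CharP.cast_eq_zero_iff k 2] at h
    rw [hm]
    exact even_iff_two_dvd.2 h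
  · rw [add_comm 1 m, ← hm] at h
    exact absurd h (leadingCoeff_ne_zero.2 hne)

end Polynomial

section RatFunc

open Polynomial (aeval)
open scoped IntermediateField

namespace RatFunc

variable {k : Type*} [Field k]

lemma X_add_one_ne_zero : (X + 1 : RatFunc k) ≠ 0 := by
  have h := algebraMap_ne_zero (Polynomial.X_add_C_ne_zero (1 : k))
  simpa using h

lemma X_sq_add_X_add_one_ne_zero : (X ^ 2 + X + 1 : RatFunc k) ≠ 0 := by
  have hp : (Polynomial.X ^ 2 + Polynomial.X + 1 : Polynomial k) ≠ 0 := fun h ↦ by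
    simpa using congrArg (Polynomial.eval 0) h
  simpa using algebraMap_ne_zero hp

lemma algEquiv_algebraMap (σ : RatFunc k ≃ₐ[k] RatFunc k) (p : Polynomial k) :
    σ (algebraMap _ _ p) = aeval (σ X) p := by
  rw [← aeval_X_left_eq_algebraMap, ← Polynomial.aeval_algHom_apply]

lemma algEquiv_ext {σ τ : RatFunc k ≃ₐ[k] RatFunc k} (h : σ X = τ X) : σ = τ := by
  ext f
  rw [← num_div_denom f, map_div₀, map_div₀]
  simp only [algEquiv_algebraMap, h]

/-- The subring `k[λ, 1/(λ(λ+1))]` of `k(λ)`. -/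
local notation "coordRing" => Algebra.adjoin k ({X, (X * (X + 1))⁻¹} : Set (RatFunc k))

lemma exists_mul_pow_eq_algebraMap {f : RatFunc k} (hf : f ∈ coordRing) :
    ∃ (n : ℕ) (P : Polynomial k), f * (X * (X + 1)) ^ n = algebraMap _ _ P := by
  have hu : (X * (X + 1) : RatFunc k) ≠ 0 := mul_ne_zero X_ne_zero X_add_one_ne_zero
  have hu' : (X * (X + 1) : RatFunc k) =
      algebraMap _ _ (Polynomial.X * (Polynomial.X + 1) : Polynomial k) := by simp
  induction hf using Algebra.adjoin_induction with
  | mem x hx =>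
    rcases hx with rfl | rfl
    · exact ⟨0, Polynomial.X, by simp⟩
    · exact ⟨1, 1, by rw [pow_one, inv_mul_cancel₀ hu, map_one]⟩
  | algebraMap r => exact ⟨0, Polynomial.C r, by simp⟩
  | add x y _ _ hx hy =>
    obtain ⟨n, P, hP⟩ := hx
    obtain ⟨m, Q, hQ⟩ := hy
    refine ⟨n + m, P * (Polynomial.X * (Polynomial.X + 1)) ^ m +
      Q * (Polynomial.X * (Polynomial.X + 1)) ^ n, ?_⟩
    rw [map_add, map_mul, map_mul, map_pow, map_pow, ← hu', ← hP, ← hQ]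
    ring
  | mul x y _ _ hx hy =>
    obtain ⟨n, P, hP⟩ := hx
    obtain ⟨m, Q, hQ⟩ := hy
    refine ⟨n + m, P * Q, ?_⟩
    rw [map_mul, ← hP, ← hQ]
    ring

lemma anharmonicOrbit_subset_coordRing : anharmonicOrbit (X : RatFunc k) ⊆ coordRing := by
  have hX0 : (X : RatFunc k) ≠ 0 := X_ne_zero
  have hX1 : (X + 1 : RatFunc k) ≠ 0 := X_add_one_ne_zero
  have hX : X ∈ coordRing := Algebra.subset_adjoin (by simp)
  have hu : (X * (X + 1))⁻¹ ∈ coordRing := Algebra.subset_adjoin (by simp)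
  have hXa : X + 1 ∈ coordRing := add_mem hX (one_mem _)
  have hi : X⁻¹ ∈ coordRing := by
    convert mul_mem hXa hu using 1
    field_simp
  have hia : (X + 1)⁻¹ ∈ coordRing := by
    convert mul_mem hX hu using 1
    field_simp
  intro y hy
  rcases mem_anharmonicOrbit.1 hy with rfl | rfl | rfl | rfl | rfl | rfl
  · exact hX
  · exact hXa
  · exact hi
  · exact hia
  · rw [div_eq_mul_inv]; exact mul_mem hX hia
  · rw [div_eq_mul_inv]; exact mul_mem hXa hi

lemma comp_X_add_one_eq_of_fixed [CharP k 2] {σ : RatFunc k ≃ₐ[k] RatFunc k} (hσ : σ X = X + 1)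
    {f : RatFunc k} (hf : σ f = f) {n : ℕ} {P : Polynomial k}
    (hP : f * (X * (X + 1)) ^ n = algebraMap _ _ P) : P.comp (Polynomial.X + 1) = P := by
  apply algebraMap_injective k
  have h := congrArg σ hP
  have h1 : (X : RatFunc k) + 1 + 1 = X := by
    linear_combination (CharTwo.two_eq_zero : (2 : RatFunc k) = 0)
  rw [map_mul, map_pow, map_mul, map_add, map_one, hf, hσ, h1, mul_comm (X + 1), hP,
    algEquiv_algebraMap, hσ] at h
  rw [h, ← aeval_X_left_eq_algebraMap, Polynomial.aeval_comp]
  simp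

lemma X_pow_mul_eq_of_fixed {τ : RatFunc k ≃ₐ[k] RatFunc k} (hτ : τ X = X⁻¹)
    {f : RatFunc k} (hf : τ f = f) {n : ℕ} {P : Polynomial k}
    (hP : f * (X * (X + 1)) ^ n = algebraMap _ _ P) :
    Polynomial.X ^ P.natDegree * P = Polynomial.X ^ (3 * n) * P.reverse := by
  have hX : (X : RatFunc k) ≠ 0 := X_ne_zero
  apply algebraMap_injective k
  have h := congrArg τ hP
  rw [map_mul, map_pow, map_mul, map_add, map_one, hf, hτ, algEquiv_algebraMap, hτ] at h
  let : Invertible (X⁻¹ : RatFunc k) := invertibleOfNonzero (inv_ne_zero hX)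
  have hr := Polynomial.eval₂_reverse_mul_pow (algebraMap k (RatFunc k)) X⁻¹ P
  rw [invOf_eq_inv, inv_inv, ← Polynomial.aeval_def, ← Polynomial.aeval_def, ← h,
    aeval_X_left_eq_algebraMap] at hr
  have hc : (X : RatFunc k) ^ 3 * (X⁻¹ * (X⁻¹ + 1)) = X * (X + 1) := by
    field_simp
    ring
  have hd : (X⁻¹ : RatFunc k) ^ P.natDegree * X ^ P.natDegree = 1 := by
    rw [← mul_pow, inv_mul_cancel₀ hX, one_pow]
  simp only [map_mul, map_pow, algebraMap_X]
  rw [← hP, ← hc, mul_pow, ← pow_mul]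
  linear_combination (-X ^ (3 * n) * X ^ P.natDegree) * hr +
    X ^ (3 * n) * (algebraMap (Polynomial k) (RatFunc k) P.reverse) * hd

lemma anharmonicInvariant_X_mul (m : ℕ) :
    anharmonicInvariant (X : RatFunc k) ^ m * (X * (X + 1)) ^ (m + m) =
      algebraMap _ _ ((Polynomial.X ^ 2 + Polynomial.X + 1 : Polynomial k) ^ (3 * m)) := by
  have hX0 : (X : RatFunc k) ≠ 0 := X_ne_zero
  have hX1 : (X + 1 : RatFunc k) ≠ 0 := X_add_one_ne_zero
  simp only [map_pow, map_add, map_one, algebraMap_X]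
  rw [← two_mul, pow_mul, pow_mul, ← mul_pow]
  congr 1
  rw [anharmonicInvariant]
  field_simp

lemma mem_adjoin_anharmonicInvariant [CharP k 2] {σ τ : RatFunc k ≃ₐ[k] RatFunc k}
    (hσ : σ X = X + 1) (hτ : τ X = X⁻¹)
    (hσJ : σ (anharmonicInvariant X) = anharmonicInvariant X)
    (hτJ : τ (anharmonicInvariant X) = anharmonicInvariant X) (n : ℕ) :
    ∀ (f : RatFunc k) (P : Polynomial k), σ f = f → τ f = f →
      f * (X * (X + 1)) ^ n = algebraMap _ _ P →
      f ∈ Algebra.adjoin k {anharmonicInvariant (X : RatFunc k)} := by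
  have hu : (X * (X + 1) : RatFunc k) ≠ 0 := mul_ne_zero X_ne_zero X_add_one_ne_zero
  induction n with
  | zero =>
    intro f P _ hf hP
    have h := X_pow_mul_eq_of_fixed hτ hf hP
    have hdeg : P.natDegree = 0 := by
      rcases eq_or_ne P 0 with rfl | hP0
      · simp
      have h' := congrArg Polynomial.natDegree h
      rw [mul_zero, pow_zero, one_mul, Polynomial.natDegree_X_pow_mul _ hP0] at h'
      have := P.reverse_natDegree_le
      lia
    rw [Polynomial.eq_C_of_natDegree_eq_zero hdeg, pow_zero, mul_one, algebraMap_C] at hP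
    rw [hP]
    exact Subalgebra.algebraMap_mem _ (P.coeff 0)
  | succ n ih =>
    have reduce (f : RatFunc k) (P : Polynomial k) (hf : σ f = f) (hf' : τ f = f)
        (hP : f * (X * (X + 1)) ^ (n + 1) = algebraMap _ _ P) (h0 : P.eval 0 = 0) :
        f ∈ Algebra.adjoin k {anharmonicInvariant (X : RatFunc k)} := by
      obtain ⟨Q, rfl⟩ := Polynomial.exists_eq_X_mul_X_add_one_mul
        (comp_X_add_one_eq_of_fixed hσ hf hP) h0
      refine ih f Q hf hf' (mul_right_cancel₀ hu ?_)
      rw [mul_assoc, ← pow_succ, hP]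
      simp
      ring
    intro f P hf hf' hP
    by_cases h0 : P.eval 0 = 0
    · exact reduce f P hf hf' hP h0
    have hP0 : P ≠ 0 := by rintro rfl; simp at h0
    have hdeg : P.natDegree = 3 * (n + 1) := by
      have h' := congrArg Polynomial.natDegree (X_pow_mul_eq_of_fixed hτ hf' hP)
      rw [Polynomial.natDegree_X_pow_mul _ hP0, Polynomial.natDegree_X_pow_mul _ (by simpa),
        Polynomial.reverse_natDegree, Polynomial.natTrailingDegree_eq_zero.2
          (Or.inr (by rwa [Polynomial.coeff_zero_eq_eval_zero]))] at h'
      lia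
    have hev := Polynomial.even_natDegree_of_comp_X_add_one (comp_X_add_one_eq_of_fixed hσ hf hP)
    obtain ⟨m, hm⟩ : Even (n + 1) := by
      rw [hdeg, Nat.even_mul] at hev
      exact hev.resolve_left (by decide)
    have hJ : anharmonicInvariant (X : RatFunc k) ^ m ∈
        Algebra.adjoin k {anharmonicInvariant (X : RatFunc k)} :=
      pow_mem (Algebra.self_mem_adjoin_singleton _ _) m
    have hsub := reduce (f - P.eval 0 • anharmonicInvariant (X : RatFunc k) ^ m)
      (P - P.eval 0 • (Polynomial.X ^ 2 + Polynomial.X + 1) ^ (3 * m))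
      (by rw [map_sub, map_smul, map_pow, hσJ, hf]) (by rw [map_sub, map_smul, map_pow, hτJ, hf'])
      (by
        rw [sub_mul, hP, smul_mul_assoc, hm, anharmonicInvariant_X_mul, map_sub,
          Algebra.smul_def, Algebra.smul_def, map_mul, ← IsScalarTower.algebraMap_apply])
      (by simp)
    simpa using add_mem hsub (Subalgebra.smul_mem _ hJ (P.eval 0))

lemma algEquiv_mem_anharmonicOrbit (σ : RatFunc k ≃ₐ[k] RatFunc k) {x y : RatFunc k}
    (h : y ∈ anharmonicOrbit x) : σ y ∈ anharmonicOrbit (σ x) := by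
  rcases mem_anharmonicOrbit.1 h with rfl | rfl | rfl | rfl | rfl | rfl <;>
    simp [anharmonicOrbit]

lemma anharmonicInvariant_mem_coordRing : anharmonicInvariant X ∈ coordRing := by
  have hX : X ∈ coordRing := Algebra.subset_adjoin (by simp)
  have hu : (X * (X + 1))⁻¹ ∈ coordRing := Algebra.subset_adjoin (by simp)
  rw [anharmonicInvariant, div_eq_mul_inv, ← mul_pow, ← inv_pow]
  exact mul_mem (pow_mem (add_mem (add_mem (pow_mem hX 2) hX) (one_mem _)) 3) (pow_mem hu 2)

section AnharmonicGroup

variable [CharP k 2]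

lemma exists_algEquiv_X_eq {y : RatFunc k} (hy : y ∈ anharmonicOrbit (X : RatFunc k)) :
    ∃ σ : RatFunc k ≃ₐ[k] RatFunc k, σ X = y := by
  have hX := mem_anharmonicOrbit_symm X_ne_zero X_add_one_ne_zero hy
  have ht : Transcendental k y := fun h ↦ transcendental_X (K := k) <|
    mem_algebraicClosure_iff.1 <|
      (algebraicClosure k (RatFunc k)).anharmonicOrbit_subset (mem_algebraicClosure_iff.2 h) hX
  have htop : k⟮y⟯ = ⊤ := by
    rw [eq_top_iff, ← adjoin_X, IntermediateField.adjoin_simple_le_iff]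
    exact k⟮y⟯.anharmonicOrbit_subset (IntermediateField.mem_adjoin_simple_self k y) hX
  refine ⟨(algEquivOfTranscendental y ht).trans
    ((IntermediateField.equivOfEq htop).trans IntermediateField.topEquiv), ?_⟩
  simp

variable (k) in
/-- The group of the six substitutions permuting `0, 1, ∞`. -/
def anharmonicGroup : Subgroup (RatFunc k ≃ₐ[k] RatFunc k) where
  carrier := {σ | σ X ∈ anharmonicOrbit X}
  one_mem' := self_mem_anharmonicOrbit X
  mul_mem' {σ _} hσ hτ := anharmonicOrbit_subset X_ne_zero X_add_one_ne_zero hσ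
    (algEquiv_mem_anharmonicOrbit σ hτ)
  inv_mem' {σ} hσ := by
    have h := algEquiv_mem_anharmonicOrbit σ⁻¹
      (mem_anharmonicOrbit_symm X_ne_zero X_add_one_ne_zero hσ)
    rwa [← AlgEquiv.mul_apply, inv_mul_cancel, AlgEquiv.one_apply] at h

lemma mem_anharmonicGroup {σ : RatFunc k ≃ₐ[k] RatFunc k} :
    σ ∈ anharmonicGroup k ↔ σ X ∈ anharmonicOrbit X := Iff.rfl

lemma card_anharmonicGroup : Nat.card (anharmonicGroup k) = 6 := by
  rw [← ncard_anharmonicOrbit (X_ne_zero (K := k)) X_add_one_ne_zero X_sq_add_X_add_one_ne_zero,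
    ← Nat.card_coe_set_eq]
  refine Nat.card_congr (Equiv.ofBijective
    (fun σ : anharmonicGroup k ↦ (⟨σ.1 X, σ.2⟩ : anharmonicOrbit (X : RatFunc k))) ⟨?_, ?_⟩)
  · intro σ τ h
    exact Subtype.ext (algEquiv_ext (congrArg Subtype.val h))
  · rintro ⟨y, hy⟩
    obtain ⟨σ, rfl⟩ := exists_algEquiv_X_eq hy
    exact ⟨⟨σ, hy⟩, rfl⟩

lemma anharmonicGroup_map_coordRing_le {σ : RatFunc k ≃ₐ[k] RatFunc k}
    (hσ : σ ∈ anharmonicGroup k) {f : RatFunc k} (hf : f ∈ coordRing) : σ f ∈ coordRing := by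
  suffices h : coordRing ≤ Subalgebra.comap (σ : RatFunc k →ₐ[k] RatFunc k) coordRing from h hf
  rw [Algebra.adjoin_le_iff]
  have hX0 : (X : RatFunc k) ≠ 0 := X_ne_zero
  have hX1 : (X + 1 : RatFunc k) ≠ 0 := X_add_one_ne_zero
  rintro x (rfl | rfl)
  · exact anharmonicOrbit_subset_coordRing hσ
  · change σ _ ∈ coordRing
    rw [map_inv₀, map_mul, map_add, map_one, mul_inv (σ X)]
    exact mul_mem (anharmonicOrbit_subset_coordRing (inv_mem_anharmonicOrbit hσ))
      (anharmonicOrbit_subset_coordRing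
        (inv_mem_anharmonicOrbit (add_one_mem_anharmonicOrbit hX0 hX1 hσ)))

lemma anharmonicGroup_image_coordRing {σ : RatFunc k ≃ₐ[k] RatFunc k}
    (hσ : σ ∈ anharmonicGroup k) : σ '' (coordRing : Set (RatFunc k)) = coordRing := by
  apply subset_antisymm
  · rintro _ ⟨f, hf, rfl⟩
    exact anharmonicGroup_map_coordRing_le hσ hf
  · intro f hf
    exact ⟨σ⁻¹ f, anharmonicGroup_map_coordRing_le (inv_mem hσ) hf, σ.apply_symm_apply f⟩

lemma anharmonicGroup_map_anharmonicInvariant {σ : RatFunc k ≃ₐ[k] RatFunc k}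
    (hσ : σ ∈ anharmonicGroup k) : σ (anharmonicInvariant X) = anharmonicInvariant X := by
  refine Eq.trans ?_ (anharmonicInvariant_eq_of_mem X_ne_zero X_add_one_ne_zero hσ)
  simp [anharmonicInvariant]

lemma invariants_anharmonicGroup :
    {f : RatFunc k | f ∈ coordRing ∧ ∀ σ ∈ anharmonicGroup k, σ f = f} =
      Algebra.adjoin k {anharmonicInvariant (X : RatFunc k)} := by
  apply subset_antisymm
  · rintro f ⟨hf, hfix⟩
    obtain ⟨n, P, hP⟩ := exists_mul_pow_eq_algebraMap hf
    have h1 : (X : RatFunc k) + 1 ∈ anharmonicOrbit X := by simp [anharmonicOrbit]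
    have h2 : (X : RatFunc k)⁻¹ ∈ anharmonicOrbit X := by simp [anharmonicOrbit]
    obtain ⟨σ, hσ⟩ := exists_algEquiv_X_eq h1
    obtain ⟨τ, hτ⟩ := exists_algEquiv_X_eq h2
    have hσΓ : σ ∈ anharmonicGroup k := mem_anharmonicGroup.2 (hσ ▸ h1)
    have hτΓ : τ ∈ anharmonicGroup k := mem_anharmonicGroup.2 (hτ ▸ h2)
    exact mem_adjoin_anharmonicInvariant hσ hτ (anharmonicGroup_map_anharmonicInvariant hσΓ)
      (anharmonicGroup_map_anharmonicInvariant hτΓ) n f P (hfix σ hσΓ) (hfix τ hτΓ) hP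
  · intro f hf
    refine ⟨Algebra.adjoin_le (Set.singleton_subset_iff.2 anharmonicInvariant_mem_coordRing) hf,
      fun σ hσ ↦ ?_⟩
    have h : Algebra.adjoin k {anharmonicInvariant (X : RatFunc k)} ≤
        AlgHom.equalizer (σ : RatFunc k →ₐ[k] RatFunc k) (AlgHom.id k _) :=
      Algebra.adjoin_le (Set.singleton_subset_iff.2 (anharmonicGroup_map_anharmonicInvariant hσ))
    exact h hf

end AnharmonicGroup

end RatFunc

end RatFunc


/-- The six substitutions `λ ↦ λ, λ+1, 1/λ, 1/(λ+1), λ/(λ+1), (λ+1)/λ`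
form a group `Γ_A` of order 6 of `k`-algebra automorphisms of the subring
`R = k[λ, 1/(λ(λ+1))]` of `k(λ)`, and the ring of `Γ_A`-invariants of `R` equals the
polynomial subring `k[J_A]` with `J_A = (λ²+λ+1)³/(λ²(λ+1)²)`. -/
theorem moduli_invariants_A (k : Type*) [Field k] [IsAlgClosed k] [CharP k 2] :
    ∃ Γ : Subgroup (RatFunc k ≃ₐ[k] RatFunc k),
      (Γ : Set (RatFunc k ≃ₐ[k] RatFunc k)) =
        {σ : RatFunc k ≃ₐ[k] RatFunc k |
          σ RatFunc.X ∈ ({RatFunc.X, RatFunc.X + 1, (RatFunc.X)⁻¹, (RatFunc.X + 1)⁻¹,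
            RatFunc.X / (RatFunc.X + 1), (RatFunc.X + 1) / RatFunc.X} : Set (RatFunc k))} ∧
      Nat.card Γ = 6 ∧
      (∀ σ ∈ Γ,
        (⇑σ) '' ↑(Algebra.adjoin k
            ({RatFunc.X, (RatFunc.X * (RatFunc.X + 1))⁻¹} : Set (RatFunc k))) =
          ↑(Algebra.adjoin k
            ({RatFunc.X, (RatFunc.X * (RatFunc.X + 1))⁻¹} : Set (RatFunc k)))) ∧
      {x : RatFunc k |
          x ∈ Algebra.adjoin k ({RatFunc.X, (RatFunc.X * (RatFunc.X + 1))⁻¹} : Set (RatFunc k)) ∧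
          ∀ σ ∈ Γ, σ x = x} =
        ↑(Algebra.adjoin k
          ({(RatFunc.X ^ 2 + RatFunc.X + 1) ^ 3 / (RatFunc.X ^ 2 * (RatFunc.X + 1) ^ 2)} :
            Set (RatFunc k))) := by
  exact ⟨RatFunc.anharmonicGroup k, rfl, RatFunc.card_anharmonicGroup,
    fun _ hσ ↦ RatFunc.anharmonicGroup_image_coordRing hσ, RatFunc.invariants_anharmonicGroup⟩
end

section
/- Let k be an algebraically closed field of characteristic 2 and let ω ∈ k satisfy ω² + ω + 1 = 0; write ω̄ = ω + 1 = ω². The twelve substitutions sending λ to λ, ωλ+1, 1/(λ+1), (λ+ω̄)/(λ+1), (ω̄λ+ω)/λ, ω̄/λ, ω/(λ+ω̄), ω̄(λ+1)/(λ+ω̄), ω̄λ/(λ+1), λ/(λ+ω̄), (λ+1)/λ, and ω̄(λ+1) form a group Γ_B of order 12 of k-algebra automorphisms of the ring R = k[λ, 1/(λ(λ+1)(λ+ω̄))], and the ring of Γ_B-invariants R^{Γ_B} is equal to the polynomial subring k[J_B], where J_B = (λ+ω)¹²/(λ³(λ+1)³(λ+ω̄)³). -/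
open Polynomial IntermediateField

namespace RatFunc

open scoped IntermediateField.algebraAdjoinAdjoin

variable {K : Type*} [Field K]

theorem natDegree_num_denom_of_isCoprime {N D : K[X]} (hND : IsCoprime N D) (hD : D ≠ 0) :
    (algebraMap K[X] (RatFunc K) N / algebraMap K[X] (RatFunc K) D).num.natDegree = N.natDegree ∧
    (algebraMap K[X] (RatFunc K) N / algebraMap K[X] (RatFunc K) D).denom.natDegree
      = D.natDegree := by
  set f := algebraMap K[X] (RatFunc K) N / algebraMap K[X] (RatFunc K) D with hf
  have h : f.num * D = N * f.denom := (num_mul_eq_mul_denom_iff hD).2 hf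
  have hc := f.isCoprime_num_denom
  have h1 : Associated f.num N :=
    associated_of_dvd_dvd (hc.dvd_of_dvd_mul_right (Dvd.intro _ h))
      (hND.dvd_of_dvd_mul_right (Dvd.intro _ h.symm))
  have h2 : Associated f.denom D :=
    associated_of_dvd_dvd (hc.symm.dvd_of_dvd_mul_left (Dvd.intro_left _ h.symm))
      (hND.symm.dvd_of_dvd_mul_left (Dvd.intro_left _ h))
  exact ⟨natDegree_eq_of_degree_eq (degree_eq_degree_of_associated h1),
    natDegree_eq_of_degree_eq (degree_eq_degree_of_associated h2)⟩

/-- The subalgebra generated by a transcendental element over a field is integrally closed. -/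
theorem _root_.Polynomial.isIntegrallyClosed_adjoin_of_transcendental {A : Type*} [CommRing A]
    [Algebra K A] {f : A} (hf : Transcendental K f) :
    IsIntegrallyClosed (Algebra.adjoin K {f}) :=
  .of_equiv (Polynomial.algEquivOfTranscendental K f hf).toRingEquiv

/-- If `x ∈ K(f)` is integral over `K[f]`, with `f` transcendental, then `x ∈ K[f]`. -/
theorem _root_.IntermediateField.mem_algebraAdjoin_of_isIntegral {L : Type*} [Field L] [Algebra K L] {f x : L}
    (hf : Transcendental K f) (hx : x ∈ K⟮f⟯)
    (hi : IsIntegral (Algebra.adjoin K {f}) x) : x ∈ Algebra.adjoin K {f} := by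
  have := isIntegrallyClosed_adjoin_of_transcendental hf
  have hi' : IsIntegral (Algebra.adjoin K {f}) (⟨x, hx⟩ : K⟮f⟯) :=
    (isIntegral_algebraMap_iff (B := L) (algebraMap K⟮f⟯ L).injective).1 hi
  obtain ⟨y, hy⟩ := IsIntegrallyClosed.isIntegral_iff.1 hi'
  have : (y : L) = x := congrArg (algebraMap K⟮f⟯ L) hy
  exact this ▸ y.2

theorem _root_.Polynomial.eq_prod_X_sub_C_of_isRoot {R ι : Type*} [Field R] [Fintype ι] {p : R[X]}
    (hp : p.Monic) {s : ι → R} (hs : Function.Injective s) (hroot : ∀ i, p.IsRoot (s i))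
    (hcard : p.natDegree = Fintype.card ι) : p = ∏ i, (Polynomial.X - Polynomial.C (s i)) := by
  have hdvd : ∏ i, (Polynomial.X - Polynomial.C (s i)) ∣ p :=
    Finset.prod_dvd_of_coprime (fun i _ j _ hij ↦ pairwise_coprime_X_sub_C hs hij)
      fun i _ ↦ dvd_iff_isRoot.2 (hroot i)
  refine eq_of_monic_of_dvd_of_natDegree_le
    (monic_prod_of_monic _ _ fun i _ ↦ monic_X_sub_C _) hp hdvd ?_
  rw [natDegree_prod_of_monic _ _ fun i _ ↦ monic_X_sub_C _]
  simp [hcard]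

/-- If the equation `N(T) = f D(T)`, where `f = N / D` with `N` monic of degree larger than `D`, has
`deg N` distinct roots `s i` in `K(X)` and `f ∈ K[s]`, then the automorphisms mapping `X` to some
`s i` form a group of order `deg N` acting on `K[s]` with ring of invariants `K[f]`. -/
theorem exists_subgroup_of_roots {ι : Type*} [Fintype ι] {N D : K[X]} (hN : N.Monic)
    (hdeg : D.natDegree < N.natDegree)
    (hD : D ≠ 0) (hND : IsCoprime N D) {s : ι → RatFunc K} (hs : Function.Injective s)
    (hcard : N.natDegree = Fintype.card ι) {f : RatFunc K}
    (hf : f = algebraMap K[X] (RatFunc K) N / algebraMap K[X] (RatFunc K) D)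
    (hroot : ∀ i, aeval (s i) N = f * aeval (s i) D)
    (hfs : f ∈ Algebra.adjoin K (Set.range s)) :
    ∃ Γ : Subgroup (RatFunc K ≃ₐ[K] RatFunc K),
      (Γ : Set (RatFunc K ≃ₐ[K] RatFunc K)) = {σ | σ X ∈ Set.range s} ∧
      Nat.card Γ = Fintype.card ι ∧
      (∀ σ ∈ Γ, σ '' (Algebra.adjoin K (Set.range s)) = Algebra.adjoin K (Set.range s)) ∧
      {x | x ∈ Algebra.adjoin K (Set.range s) ∧ ∀ σ ∈ Γ, σ x = x} = Algebra.adjoin K {f} := by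
  classical
  obtain ⟨hn, hd⟩ := natDegree_num_denom_of_isCoprime hND hD
  rw [← hf] at hn hd
  have hC : ¬ ∃ c, f = C c := by
    rintro ⟨c, rfl⟩
    simp at hn
    omega
  have htr := f.transcendental_of_ne_C hC
  have hfr : Module.finrank K⟮f⟯ (RatFunc K) = Fintype.card ι := by
    rw [finrank_eq_max_natDegree, hn, hd, max_eq_left hdeg.le, hcard]
  have hdegC : ∀ {R : Type _} [Field R] [Algebra K R] (g : R),
      (Polynomial.C g * D.map (algebraMap K R)).degree < (N.map (algebraMap K R)).degree := by
    intro R _ _ g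
    refine (degree_mul_le _ _).trans_lt ?_
    rw [degree_map, degree_map]
    refine lt_of_le_of_lt (add_le_add_left degree_C_le _) ?_
    rw [zero_add]
    exact degree_lt_degree hdeg
  let P : (RatFunc K)[X] :=
    N.map (algebraMap K (RatFunc K)) - Polynomial.C f * D.map (algebraMap K (RatFunc K))
  have hPm : P.Monic := (hN.map _).sub_of_left (hdegC f)
  have hPn : P.natDegree = Fintype.card ι := by
    rw [natDegree_eq_of_degree_eq (degree_sub_eq_left_of_degree_lt (hdegC f)), natDegree_map, hcard]
  have hPeval : ∀ y, P.eval y = aeval y N - f * aeval y D := fun y ↦ by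
    simp [P, aeval_def, eval_map]
  have hP : P = ∏ i, (Polynomial.X - Polynomial.C (s i)) :=
    eq_prod_X_sub_C_of_isRoot hPm hs (fun i ↦ by simp [IsRoot, hPeval, hroot]) hPn
  have hPmem : ∀ y, aeval y N = f * aeval y D ↔ y ∈ Set.range s := fun y ↦ by
    rw [← sub_eq_zero, ← hPeval, hP, eval_prod, Finset.prod_eq_zero_iff]
    simp [sub_eq_zero, eq_comm]
  have hX : (X : RatFunc K) ∈ Set.range s := by
    rw [← hPmem, hf, aeval_X_left_eq_algebraMap, aeval_X_left_eq_algebraMap,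
      div_mul_cancel₀ _ (algebraMap_ne_zero hD)]
  let Q : K⟮f⟯[X] := N.map (algebraMap K K⟮f⟯) -
    Polynomial.C (AdjoinSimple.gen K f) * D.map (algebraMap K K⟮f⟯)
  have hQ : Q.map (algebraMap K⟮f⟯ (RatFunc K)) = P := by
    simp [Q, P, Polynomial.map_map, ← IsScalarTower.algebraMap_eq]
  have hfd : FiniteDimensional K⟮f⟯ (RatFunc K) := by
    apply FiniteDimensional.of_finrank_pos
    omega
  have hsplit : Q.IsSplittingField K⟮f⟯ (RatFunc K) := by
    refine isSplittingField_iff_intermediateField.2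
      ⟨hQ ▸ hP ▸ Splits.prod fun i _ ↦ Splits.X_sub_C _, top_unique ?_⟩
    rw [← IntermediateField.adjoin_X K⟮f⟯]
    refine adjoin.mono _ _ _ (Set.singleton_subset_iff.2 ?_)
    rw [mem_rootSet', hQ, ← eval_map_algebraMap, hQ, hPeval, (hPmem X).2 hX, sub_self]
    exact ⟨hPm.ne_zero, rfl⟩
  have hgal : IsGalois K⟮f⟯ (RatFunc K) := by
    refine IsGalois.of_separable_splitting_field (p := Q) ?_
    rw [← separable_map (algebraMap K⟮f⟯ (RatFunc K)), hQ, hP]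
    exact separable_prod_X_sub_C_iff.2 hs
  have hmem : ∀ σ : RatFunc K ≃ₐ[K] RatFunc K, σ ∈ K⟮f⟯.fixingSubgroup ↔ σ f = f := by
    intro σ
    rw [IntermediateField.mem_fixingSubgroup_iff]
    refine ⟨fun h ↦ h f (mem_adjoin_simple_self K f), fun h x hx ↦ ?_⟩
    have : (σ : RatFunc K →ₐ[K] RatFunc K).comp K⟮f⟯.val = K⟮f⟯.val := by
      apply IntermediateField.algHom_ext_of_eq_adjoin _ rfl
      simpa using h
    exact DFunLike.congr_fun this ⟨x, hx⟩
  have hperm : ∀ σ ∈ K⟮f⟯.fixingSubgroup, ∀ y ∈ Set.range s, σ y ∈ Set.range s := by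
    intro σ hσ y hy
    rw [hmem] at hσ
    rw [← hPmem] at hy ⊢
    have := congrArg σ hy
    rwa [map_mul, hσ, ← aeval_algHom_apply, ← aeval_algHom_apply] at this
  have himg : ∀ σ ∈ K⟮f⟯.fixingSubgroup, ∀ y ∈ Algebra.adjoin K (Set.range s),
      σ y ∈ Algebra.adjoin K (Set.range s) := by
    intro σ hσ y hy
    have : Algebra.adjoin K (Set.range s) ≤
        (Algebra.adjoin K (Set.range s)).comap (σ : RatFunc K →ₐ[K] RatFunc K) :=
      Algebra.adjoin_le fun z hz ↦ Algebra.subset_adjoin (hperm σ hσ z hz)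
    exact this hy
  refine ⟨K⟮f⟯.fixingSubgroup, ?_, ?_, ?_, ?_⟩
  · ext σ
    rw [SetLike.mem_coe, Set.mem_ofPred_eq]
    refine ⟨fun h ↦ hperm σ h _ hX, fun h ↦ ?_⟩
    rw [hmem]
    rw [← hPmem] at h
    have hσ : ∀ p : K[X], aeval (σ X) p = σ (algebraMap K[X] (RatFunc K) p) := fun p ↦ by
      rw [← aeval_X_left_eq_algebraMap]
      exact aeval_algHom_apply (σ : RatFunc K →ₐ[K] RatFunc K) X p
    rw [hσ, hσ] at h
    conv_lhs => rw [hf]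
    rw [map_div₀, h, mul_div_cancel_right₀]
    simpa using hD
  · rw [Nat.card_congr (fixingSubgroupEquiv K⟮f⟯).toEquiv, IsGalois.card_aut_eq_finrank, hfr]
  · intro σ hσ
    apply subset_antisymm
    · rintro _ ⟨y, hy, rfl⟩
      exact himg σ hσ y hy
    · intro y hy
      exact ⟨σ⁻¹ y, himg _ (inv_mem hσ) y hy, σ.apply_symm_apply y⟩
  · ext x
    refine ⟨fun ⟨hx, hfix⟩ ↦ ?_, fun hx ↦ ⟨?_, fun σ hσ ↦ ?_⟩⟩
    · refine mem_algebraAdjoin_of_isIntegral htr ?_ ?_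
      · obtain ⟨y, hy⟩ := (IsGalois.mem_range_algebraMap_iff_fixed (F := K⟮f⟯) x).2 fun τ ↦
          hfix _ ((fixingSubgroupEquiv K⟮f⟯).symm τ).2
        exact hy ▸ y.2
      · have : Algebra.adjoin K (Set.range s) ≤
            (integralClosure (Algebra.adjoin K {f}) (RatFunc K)).restrictScalars K := by
          refine Algebra.adjoin_le ?_
          intro y hy
          let T : (Algebra.adjoin K {f})[X] := N.map (algebraMap K _) -
            Polynomial.C ⟨f, Algebra.self_mem_adjoin_singleton K f⟩ * D.map (algebraMap K _)
          have hT : T.map (algebraMap _ (RatFunc K)) = P := by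
            simp [T, P, Polynomial.map_map, ← IsScalarTower.algebraMap_eq]
          refine ⟨T, ?_, ?_⟩
          · refine monic_of_injective (FaithfulSMul.algebraMap_injective _ (RatFunc K)) ?_
            rwa [hT]
          · rw [← eval_map, hT, hPeval, (hPmem y).2 hy, sub_self]
        exact this hx
    · exact Algebra.adjoin_le (Set.singleton_subset_iff.2 hfs) hx
    · exact (IntermediateField.mem_fixingSubgroup_iff _ _).1 hσ x
        (algebra_adjoin_le_adjoin K {f} hx)

/-- The twelve Möbius substitutions defined over `𝔽₄` that fix the point `ω`. -/
def mobiusFixingOmega {L : Type*} [Field L] (w x : L) : Fin 12 → L :=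
  ![x, w * x + 1, (x + 1)⁻¹, (x + (w + 1)) / (x + 1), ((w + 1) * x + w) / x, (w + 1) / x,
    w / (x + (w + 1)), (w + 1) * (x + 1) / (x + (w + 1)), (w + 1) * x / (x + 1),
    x / (x + (w + 1)), (x + 1) / x, (w + 1) * (x + 1)]

theorem range_mobiusFixingOmega {L : Type*} [Field L] (w x : L) :
    Set.range (mobiusFixingOmega w x) =
      {x, w * x + 1, (x + 1)⁻¹, (x + (w + 1)) / (x + 1), ((w + 1) * x + w) / x, (w + 1) / x,
        w / (x + (w + 1)), (w + 1) * (x + 1) / (x + (w + 1)), (w + 1) * x / (x + 1),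
        x / (x + (w + 1)), (x + 1) / x, (w + 1) * (x + 1)} := by
  simp only [mobiusFixingOmega, Matrix.range_cons, Matrix.range_empty, Set.union_empty,
    Set.singleton_union]

section mobiusFixingOmega

variable {L : Type*} [Field L] [CharP L 2] {w x : L}

theorem mobiusFixingOmega_injective (hw : w ^ 2 + w + 1 = 0) (hx : x ^ 4 ≠ x) :
    Function.Injective (mobiusFixingOmega w x) := by
  have h0 : x ≠ 0 := by grind
  have h1 : x + 1 ≠ 0 := by grind
  have hw1 : x + (w + 1) ≠ 0 := by grind
  have h2 : (2 : L) = 0 := CharTwo.two_eq_zero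
  intro i j h
  by_contra hij
  wlog hlt : i < j generalizing i j
  · exact this h.symm (Ne.symm hij) (by omega)
  fin_cases i <;> fin_cases j <;> first | (exfalso; revert hlt; decide) | skip
  all_goals
    simp [mobiusFixingOmega] at h
    field_simp at h
    grind

theorem mobiusFixingOmega_invariant (hw : w ^ 2 + w + 1 = 0) (hx : x ^ 4 ≠ x) (i : Fin 12) :
    (mobiusFixingOmega w x i + w) ^ 12 * (x ^ 3 * (x + 1) ^ 3 * (x + (w + 1)) ^ 3) =
      (x + w) ^ 12 * (mobiusFixingOmega w x i ^ 3 * (mobiusFixingOmega w x i + 1) ^ 3 *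
        (mobiusFixingOmega w x i + (w + 1)) ^ 3) := by
  suffices ∃ e : L, e ^ 3 = 1 ∧
      (mobiusFixingOmega w x i + w) ^ 4 * (x * (x + 1) * (x + (w + 1))) =
        e * ((x + w) ^ 4 * (mobiusFixingOmega w x i * (mobiusFixingOmega w x i + 1) *
          (mobiusFixingOmega w x i + (w + 1)))) by
    obtain ⟨e, he, h⟩ := this
    have := congrArg (· ^ 3) h
    simp only [mul_pow, he, ← pow_mul, Nat.reduceMul, one_mul] at this
    exact this
  have h0 : x ≠ 0 := by grind
  have h1 : x + 1 ≠ 0 := by grind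
  have hw1 : x + (w + 1) ≠ 0 := by grind
  have hw' : w ^ 2 = w + 1 := by grind
  clear hx hw
  fin_cases i
  all_goals
    simp [mobiusFixingOmega]
    first
    | (refine ⟨1, by grind, ?_⟩; field_simp; done)
    | (refine ⟨1, by grind, ?_⟩; field_simp; grind)
    | (refine ⟨w, by grind, ?_⟩; field_simp; grind)
    | (refine ⟨w + 1, by grind, ?_⟩; field_simp; grind)

theorem adjoin_mobiusFixingOmega {k : Type*} [Field k] [Algebra k L] {ω : k}
    (hω : ω ^ 2 + ω + 1 = 0) (hw : algebraMap k L ω = w) (hx : x ^ 4 ≠ x) :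
    Algebra.adjoin k (Set.range (mobiusFixingOmega w x)) =
      Algebra.adjoin k {x, (x * (x + 1) * (x + (w + 1)))⁻¹} := by
  have hw2 : w ^ 2 + w + 1 = 0 := by
    rw [← hw, ← map_pow, ← map_add, ← map_one (algebraMap k L), ← map_add, hω, map_zero]
  have h0 : x ≠ 0 := by grind
  have h1 : x + 1 ≠ 0 := by grind
  have hw1 : x + (w + 1) ≠ 0 := by grind
  have hw_mem : ∀ A : Subalgebra k L, w ∈ A := fun A ↦ hw ▸ A.algebraMap_mem ω
  apply le_antisymm
  · set A := Algebra.adjoin k {x, (x * (x + 1) * (x + (w + 1)))⁻¹} with hA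
    have hwA := hw_mem A
    have hwA' : w + 1 ∈ A := add_mem hwA (one_mem A)
    have hxA : x ∈ A := Algebra.subset_adjoin (by simp)
    have hx1A : x + 1 ∈ A := add_mem hxA (one_mem A)
    have hxwA : x + (w + 1) ∈ A := add_mem hxA hwA'
    have hd : (x * (x + 1) * (x + (w + 1)))⁻¹ ∈ A := Algebra.subset_adjoin (by simp)
    have i0 : x⁻¹ ∈ A := by
      convert mul_mem (mul_mem hx1A hxwA) hd using 1
      field_simp
    have i1 : (x + 1)⁻¹ ∈ A := by
      convert mul_mem (mul_mem hxA hxwA) hd using 1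
      field_simp
    have i2 : (x + (w + 1))⁻¹ ∈ A := by
      convert mul_mem (mul_mem hxA hx1A) hd using 1
      field_simp
    refine Algebra.adjoin_le (Set.range_subset_iff.2 fun i ↦ ?_)
    rw [SetLike.mem_coe]
    fin_cases i <;> simp only [mobiusFixingOmega, div_eq_mul_inv]
    exacts [hxA, add_mem (mul_mem hwA hxA) (one_mem A), i1, mul_mem hxwA i1,
      mul_mem (add_mem (mul_mem hwA' hxA) hwA) i0, mul_mem hwA' i0, mul_mem hwA i2,
      mul_mem (mul_mem hwA' hx1A) i2, mul_mem (mul_mem hwA' hxA) i1, mul_mem hxA i2,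
      mul_mem hx1A i0, mul_mem hwA' hx1A]
  · set A := Algebra.adjoin k (Set.range (mobiusFixingOmega w x)) with hA
    have hmem : ∀ i, mobiusFixingOmega w x i ∈ A := fun i ↦ Algebra.subset_adjoin ⟨i, rfl⟩
    refine Algebra.adjoin_le ?_
    rintro y (rfl | rfl)
    · exact hmem 0
    · have i0 : (w + 1) / x ∈ A := hmem 5
      have i1 : (x + 1)⁻¹ ∈ A := hmem 2
      have i2 : w / (x + (w + 1)) ∈ A := hmem 6
      rw [SetLike.mem_coe]
      convert mul_mem (mul_mem i0 i1) i2 using 1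
      field_simp
      grind

end mobiusFixingOmega

end RatFunc

/-- The twelve substitutions listed below form a group `Γ_B` of order 12 of
`k`-algebra automorphisms of the subring `R = k[λ, 1/(λ(λ+1)(λ+ω̄))]` of `k(λ)`
(char k = 2, ω a primitive cube root of unity, ω̄ = ω+1), and the ring of
`Γ_B`-invariants of `R` equals the polynomial subring `k[J_B]` with
`J_B = (λ+ω)¹²/(λ³(λ+1)³(λ+ω̄)³)`. -/
theorem moduli_invariants_B (k : Type*) [Field k] [IsAlgClosed k] [CharP k 2]
    (ω : k) (hω : ω ^ 2 + ω + 1 = 0) :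
    ∃ Γ : Subgroup (RatFunc k ≃ₐ[k] RatFunc k),
      (Γ : Set (RatFunc k ≃ₐ[k] RatFunc k)) =
        {σ : RatFunc k ≃ₐ[k] RatFunc k |
          σ RatFunc.X ∈
            ({RatFunc.X,
              RatFunc.C ω * RatFunc.X + 1,
              (RatFunc.X + 1)⁻¹,
              (RatFunc.X + RatFunc.C (ω + 1)) / (RatFunc.X + 1),
              (RatFunc.C (ω + 1) * RatFunc.X + RatFunc.C ω) / RatFunc.X,
              RatFunc.C (ω + 1) / RatFunc.X,
              RatFunc.C ω / (RatFunc.X + RatFunc.C (ω + 1)),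
              RatFunc.C (ω + 1) * (RatFunc.X + 1) / (RatFunc.X + RatFunc.C (ω + 1)),
              RatFunc.C (ω + 1) * RatFunc.X / (RatFunc.X + 1),
              RatFunc.X / (RatFunc.X + RatFunc.C (ω + 1)),
              (RatFunc.X + 1) / RatFunc.X,
              RatFunc.C (ω + 1) * (RatFunc.X + 1)} : Set (RatFunc k))} ∧
      Nat.card Γ = 12 ∧
      (∀ σ ∈ Γ,
        (⇑σ) '' ↑(Algebra.adjoin k
            ({RatFunc.X, (RatFunc.X * (RatFunc.X + 1) * (RatFunc.X + RatFunc.C (ω + 1)))⁻¹} :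
              Set (RatFunc k))) =
          ↑(Algebra.adjoin k
            ({RatFunc.X, (RatFunc.X * (RatFunc.X + 1) * (RatFunc.X + RatFunc.C (ω + 1)))⁻¹} :
              Set (RatFunc k)))) ∧
      {x : RatFunc k |
          x ∈ Algebra.adjoin k
              ({RatFunc.X, (RatFunc.X * (RatFunc.X + 1) * (RatFunc.X + RatFunc.C (ω + 1)))⁻¹} :
                Set (RatFunc k)) ∧
          ∀ σ ∈ Γ, σ x = x} =
        ↑(Algebra.adjoin k
          ({(RatFunc.X + RatFunc.C ω) ^ 12 /
              (RatFunc.X ^ 3 * (RatFunc.X + 1) ^ 3 *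
                (RatFunc.X + RatFunc.C (ω + 1)) ^ 3)} : Set (RatFunc k))) := by
  have hchar : CharP (RatFunc k) 2 :=
    charP_of_injective_algebraMap (algebraMap k (RatFunc k)).injective 2
  have h2 : (2 : k) = 0 := CharTwo.two_eq_zero
  have hx : (RatFunc.X : RatFunc k) ^ 4 ≠ RatFunc.X := by
    rw [← RatFunc.algebraMap_X, ← map_pow]
    intro h
    have := congrArg Polynomial.natDegree (RatFunc.algebraMap_injective k h)
    simp at this
  have hw : (RatFunc.C ω) ^ 2 + RatFunc.C ω + 1 = 0 := by
    rw [← map_pow, ← map_add, ← map_one RatFunc.C, ← map_add, hω, map_zero]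
  have hC1 : RatFunc.C (ω + 1) = RatFunc.C ω + 1 := by simp
  have hd := RatFunc.adjoin_mobiusFixingOmega (w := RatFunc.C ω) hω rfl hx
  have h0 : (RatFunc.X : RatFunc k) ≠ 0 := by grind
  have h1 : (RatFunc.X : RatFunc k) + 1 ≠ 0 := by grind
  have hw1 : (RatFunc.X : RatFunc k) + (RatFunc.C ω + 1) ≠ 0 := by grind
  let N : Polynomial k := (X + Polynomial.C ω) ^ 12
  let D : Polynomial k := X ^ 3 * (X + Polynomial.C 1) ^ 3 * (X + Polynomial.C (ω + 1)) ^ 3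
  have hcop : ∀ b : k, ω ≠ b → IsCoprime (X + Polynomial.C ω) (X + Polynomial.C b) := by
    intro b hb
    have := Polynomial.isCoprime_X_sub_C_of_isUnit_sub (a := -ω) (b := -b)
      (sub_ne_zero.2 (neg_injective.ne hb)).isUnit
    simpa using this
  have hN : N.Monic := (Polynomial.monic_X_add_C ω).pow 12
  have hD : D.Monic := ((Polynomial.monic_X_pow 3).mul ((Polynomial.monic_X_add_C 1).pow 3)).mul
    ((Polynomial.monic_X_add_C (ω + 1)).pow 3)
  have hNdeg : N.natDegree = 12 := by simp [N]
  have hDdeg : D.natDegree = 9 := by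
    simp only [D]
    compute_degree!
  have hND : IsCoprime N D := by
    refine ((IsCoprime.pow ?_).mul_right (hcop 1 ?_).pow).mul_right (hcop (ω + 1) ?_).pow
    · simpa using hcop 0 (by grind)
    · grind
    · grind
  have hNx : ∀ y : RatFunc k, Polynomial.aeval y N = (y + RatFunc.C ω) ^ 12 := fun y ↦ by
    simp [N, ← RatFunc.algebraMap_eq_C]
  have hDx : ∀ y : RatFunc k, Polynomial.aeval y D =
      y ^ 3 * (y + 1) ^ 3 * (y + (RatFunc.C ω + 1)) ^ 3 := fun y ↦ by
    simp [D, ← RatFunc.algebraMap_eq_C]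
  simp only [hC1]
  rw [← RatFunc.range_mobiusFixingOmega, ← hd]
  convert RatFunc.exists_subgroup_of_roots hN (by omega) hD.ne_zero hND
    (RatFunc.mobiusFixingOmega_injective hw hx) (by simp [hNdeg]) ?_ ?_ ?_ using 8
  · simp
  · rw [← RatFunc.aeval_X_left_eq_algebraMap, ← RatFunc.aeval_X_left_eq_algebraMap, hNx, hDx]
  · intro i
    have := RatFunc.mobiusFixingOmega_invariant hw hx i
    rw [hNx, hDx]
    field_simp
    linear_combination this
  · rw [hd]
    have hXm : RatFunc.X ∈ Algebra.adjoin k {(RatFunc.X : RatFunc k),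
      (RatFunc.X * (RatFunc.X + 1) * (RatFunc.X + (RatFunc.C ω + 1)))⁻¹} :=
      Algebra.subset_adjoin (by simp)
    have hDm : (RatFunc.X * (RatFunc.X + 1) * (RatFunc.X + (RatFunc.C ω + 1)))⁻¹ ∈
      Algebra.adjoin k {(RatFunc.X : RatFunc k),
        (RatFunc.X * (RatFunc.X + 1) * (RatFunc.X + (RatFunc.C ω + 1)))⁻¹} :=
      Algebra.subset_adjoin (by simp)
    rw [div_eq_mul_inv, ← mul_pow, ← mul_pow, ← inv_pow]
    exact mul_mem (pow_mem (add_mem hXm (Subalgebra.algebraMap_mem _ ω)) 12) (pow_mem hDm 3)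
end

section
/- Let k be an algebraically closed field of characteristic 2 and let ω ∈ k satisfy ω² + ω + 1 = 0; let F₄ = {0, 1, ω, ω+1} be the four-element subfield of k. The twelve substitutions λ ↦ αλ + β with α ∈ F₄ \ {0} and β ∈ F₄ form a group Γ_C of order 12 of k-algebra automorphisms of the polynomial ring k[λ], and the ring of Γ_C-invariants k[λ]^{Γ_C} is equal to the polynomial subring k[J_C], where J_C = (λ⁴+λ)³. -/
open Polynomial in
/-- An algebra endomorphism of `k[X]` is composition with the image of `X`. -/
theorem Polynomial.algEquiv_apply_eq_comp {k : Type*} [CommRing k] (σ : k[X] ≃ₐ[k] k[X])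
    (p : k[X]) : σ p = p.comp (σ X) := by
  have h : (σ : k[X] →ₐ[k] k[X]) = aeval (σ X) := by
    ext
    simp
  have h' := DFunLike.congr_fun h p
  rwa [AlgEquiv.coe_toAlgHom, ← comp_eq_aeval] at h'

namespace CharTwoAffine

open Polynomial

variable {k : Type*} [Field k]

theorem natDegree_invariant_sub_C (c : k) :
    (((X ^ 4 + X) ^ 3 - C c : k[X])).natDegree = 12 := by
  compute_degree!

theorem monic_invariant_sub_C (c : k) : ((X ^ 4 + X) ^ 3 - C c : k[X]).Monic := by
  monicity!

variable [CharP k 2]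

theorem add_pow_four {R : Type*} [CommRing R] [CharP R 2] (a b : R) :
    (a + b) ^ 4 = a ^ 4 + b ^ 4 :=
  add_pow_char_pow (p := 2) (n := 2) a b

theorem mem_units_iff {ω : k} (hω : ω ^ 2 + ω + 1 = 0) (a : k) :
    a ∈ ({1, ω, ω + 1} : Set k) ↔ a ^ 3 = 1 := by
  have h2 : (2 : k) = 0 := CharTwo.two_eq_zero
  have key : a ^ 3 - 1 = (a - 1) * ((a - ω) * (a - (ω + 1))) := by
    linear_combination (1 - a) * hω + (a - 1) * (a * ω + a + 1) * h2
  rw [← sub_eq_zero (a := a ^ 3), key]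
  simp [sub_eq_zero]

theorem mem_field_iff {ω : k} (hω : ω ^ 2 + ω + 1 = 0) (a : k) :
    a ∈ ({0, 1, ω, ω + 1} : Set k) ↔ a ^ 4 = a := by
  rw [Set.mem_insert_iff, mem_units_iff hω, ← sub_eq_zero (a := a ^ 4),
    show a ^ 4 - a = a * (a ^ 3 - 1) by ring, mul_eq_zero, sub_eq_zero]

/-- The group of affine substitutions of `k[X]` with coefficients in the field with four
elements, where `k` has characteristic two. -/
def affineGroup (k : Type*) [Field k] [CharP k 2] : Subgroup (k[X] ≃ₐ[k] k[X]) where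
  carrier := {σ | ∃ α β : k, α ^ 3 = 1 ∧ β ^ 4 = β ∧ σ X = C α * X + C β}
  one_mem' := ⟨1, 0, by simp, by simp, by simp⟩
  mul_mem' := by
    rintro σ τ ⟨a, b, ha, hb, hσ⟩ ⟨c, d, hc, hd, hτ⟩
    refine ⟨c * a, c * b + d, by rw [mul_pow, ha, hc, one_mul], ?_, ?_⟩
    · rw [add_pow_four, mul_pow, hb, hd, pow_succ c 3, hc, one_mul]
    · rw [AlgEquiv.mul_apply, hτ, algEquiv_apply_eq_comp, hσ]
      simp
      ring
  inv_mem' := by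
    rintro σ ⟨a, b, ha, hb, hσ⟩
    have ha' : a ^ 2 * a = 1 := by rw [← ha]; ring
    refine ⟨a ^ 2, -(a ^ 2 * b), by rw [← pow_mul, mul_comm, pow_mul, ha, one_pow], ?_, ?_⟩
    · rw [Even.neg_pow (by decide), mul_pow, hb, CharTwo.neg_eq]
      linear_combination (a ^ 5 + a ^ 2) * b * ha
    · apply σ.injective
      rw [← AlgEquiv.mul_apply, mul_inv_cancel, AlgEquiv.one_apply, algEquiv_apply_eq_comp, hσ]
      have hC : C a ^ 2 * C a = 1 := by rw [← C_pow, ← C_mul, ha', C_1]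
      simp
      linear_combination -X * hC

theorem mem_affineGroup {σ : k[X] ≃ₐ[k] k[X]} :
    σ ∈ affineGroup k ↔ ∃ α β : k, α ^ 3 = 1 ∧ β ^ 4 = β ∧ σ X = C α * X + C β :=
  Iff.rfl

theorem exists_mem_affineGroup {α β : k} (hα : α ^ 3 = 1) (hβ : β ^ 4 = β) :
    ∃ σ ∈ affineGroup k, σ X = C α * X + C β := by
  have hα0 : α ≠ 0 := by
    rintro rfl
    simp at hα
  let := invertibleOfNonzero hα0
  have h : algEquivCMulXAddC α β X = C α * X + C β := by simp
  exact ⟨_, ⟨α, β, hα, hβ, h⟩, h⟩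

theorem affine_injective_of_pow_four_ne {x α β α' β' : k} (hx : x ^ 4 ≠ x) (hα : α ^ 3 = 1)
    (hβ : β ^ 4 = β) (hα' : α' ^ 3 = 1) (hβ' : β' ^ 4 = β')
    (h : α * x + β = α' * x + β') : α = α' ∧ β = β' := by
  have h4 : (α * x + β) ^ 4 = (α' * x + β') ^ 4 := by rw [h]
  rw [add_pow_four, add_pow_four, mul_pow, mul_pow, hβ, hβ', pow_succ α, pow_succ α', hα, hα',
    one_mul, one_mul] at h4
  have hz : (α - α') * (x ^ 4 - x) = 0 := by linear_combination h4 - h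
  obtain rfl : α = α' :=
    sub_eq_zero.mp ((mul_eq_zero.mp hz).resolve_right (sub_ne_zero.mpr hx))
  exact ⟨rfl, add_left_cancel h⟩

theorem map_invariant {σ : k[X] ≃ₐ[k] k[X]} (hσ : σ ∈ affineGroup k) :
    σ ((X ^ 4 + X) ^ 3) = (X ^ 4 + X) ^ 3 := by
  obtain ⟨a, b, ha, hb, h⟩ := hσ
  have hb' : C b ^ 4 = C b := by rw [← C_pow, hb]
  have ha' : C a ^ 3 = 1 := by rw [← C_pow, ha, C_1]
  have h2 : (2 : k[X]) = 0 := CharTwo.two_eq_zero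
  have h4 : (C a * X + C b) ^ 4 + (C a * X + C b) = C a * (X ^ 4 + X) := by
    rw [add_pow_four, mul_pow, hb', pow_succ (C a), ha']
    linear_combination C b * h2
  rw [map_pow, map_add, map_pow, h, h4, mul_pow, ha', one_mul]

theorem exists_finset_param {ω : k} (hω : ω ^ 2 + ω + 1 = 0) :
    ∃ P : Finset (k × k), P.card = 12 ∧ ∀ q, q ∈ P ↔ q.1 ^ 3 = 1 ∧ q.2 ^ 4 = q.2 := by
  classical
  have h0 : ω ≠ 0 := by
    rintro rfl
    simp at hω
  have h1 : ω + 1 ≠ 0 := by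
    intro h
    have : ω * (ω + 1) + 1 = 0 := by linear_combination hω
    simp [h] at this
  have h1' : 1 ≠ ω := by
    rintro rfl
    exact h1 (CharTwo.add_self_eq_zero 1)
  refine ⟨{1, ω, ω + 1} ×ˢ {0, 1, ω, ω + 1}, ?_, fun q ↦ ?_⟩
  · rw [Finset.card_product, Finset.card_eq_three.mpr ⟨1, ω, ω + 1, h1', by simpa using h0,
      by simp, rfl⟩, Finset.card_insert_of_notMem (by simp [h0.symm, h1.symm]),
      Finset.card_eq_three.mpr ⟨1, ω, ω + 1, h1', by simpa using h0, by simp, rfl⟩]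
  · rw [← mem_units_iff hω, ← mem_field_iff hω]
    simp

theorem card_affineGroup {ω : k} (hω : ω ^ 2 + ω + 1 = 0) : Nat.card (affineGroup k) = 12 := by
  classical
  obtain ⟨P, hP, hmem⟩ := exists_finset_param hω
  have hinj : Function.Injective fun σ : k[X] ≃ₐ[k] k[X] ↦ σ X := fun σ τ h ↦
    AlgEquiv.ext fun p ↦ by
      rw [algEquiv_apply_eq_comp, algEquiv_apply_eq_comp τ]
      exact congrArg p.comp h
  have hginj : Function.Injective fun q : k × k ↦ C q.1 * X + C q.2 := fun q r h ↦ by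
    have h0 := congrArg (coeff · 0) h
    have h1 := congrArg (coeff · 1) h
    simp [coeff_C] at h0 h1
    exact Prod.ext h1 h0
  have himage : (fun σ : k[X] ≃ₐ[k] k[X] ↦ σ X) '' (affineGroup k : Set _) =
      (P.image fun q ↦ C q.1 * X + C q.2 : Finset k[X]) := by
    ext p
    simp only [Set.mem_image, SetLike.mem_coe, Finset.coe_image, Prod.exists, hmem]
    constructor
    · rintro ⟨σ, ⟨a, b, ha, hb, h⟩, rfl⟩
      exact ⟨a, b, ⟨ha, hb⟩, h.symm⟩
    · rintro ⟨a, b, ⟨ha, hb⟩, rfl⟩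
      exact exists_mem_affineGroup ha hb
  change (affineGroup k : Set (k[X] ≃ₐ[k] k[X])).ncard = 12
  rw [← Set.ncard_image_of_injective _ hinj, himage, Set.ncard_coe_finset,
    Finset.card_image_of_injective _ hginj, hP]

theorem dvd_sub_C_eval {ω : k} (hω : ω ^ 2 + ω + 1 = 0) {x : k} (hx : x ^ 4 ≠ x) {p : k[X]}
    (hp : ∀ σ ∈ affineGroup k, σ p = p) :
    (X ^ 4 + X) ^ 3 - C (((X ^ 4 + X) ^ 3 : k[X]).eval x) ∣ p - C (p.eval x) := by
  classical
  obtain ⟨P, hP, hmem⟩ := exists_finset_param hω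
  have heval {f : k[X]} (hf : ∀ σ ∈ affineGroup k, σ f = f) {q : k × k} (hq : q ∈ P) :
      f.eval (q.1 * x + q.2) = f.eval x := by
    obtain ⟨σ, hσ, hσX⟩ :=
      exists_mem_affineGroup ((hmem q).mp hq).1 ((hmem q).mp hq).2
    conv_rhs => rw [← hf σ hσ, algEquiv_apply_eq_comp, hσX]
    simp
  have hinj : Set.InjOn (fun q : k × k ↦ q.1 * x + q.2) P := fun q hq r hr h ↦ by
    have hq := (hmem q).mp hq
    have hr := (hmem r).mp hr
    exact Prod.ext_iff.mpr (affine_injective_of_pow_four_ne hx hq.1 hq.2 hr.1 hr.2 h)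
  set c := ((X ^ 4 + X) ^ 3 : k[X]).eval x
  have hmonic := monic_invariant_sub_C c
  rw [← modByMonic_eq_zero_iff_dvd hmonic]
  refine eq_zero_of_degree_lt_of_eval_finset_eq_zero (P.image fun q ↦ q.1 * x + q.2) ?_ ?_
  · rw [Finset.card_image_of_injOn hinj, hP]
    refine (degree_modByMonic_lt _ hmonic).trans_eq ?_
    rw [degree_eq_natDegree hmonic.ne_zero, natDegree_invariant_sub_C]
  · intro y hy
    obtain ⟨q, hq, rfl⟩ := Finset.mem_image.mp hy
    rw [modByMonic_eq_sub_mul_div _ _, eval_sub, eval_mul, eval_sub, eval_sub, eval_C, eval_C,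
      heval hp hq, heval (fun σ ↦ map_invariant) hq]
    simp [c]

theorem mem_adjoin_of_forall_map_eq [Infinite k] {ω : k} (hω : ω ^ 2 + ω + 1 = 0) {p : k[X]}
    (hp : ∀ σ ∈ affineGroup k, σ p = p) :
    p ∈ Algebra.adjoin k ({(X ^ 4 + X) ^ 3} : Set k[X]) := by
  obtain ⟨x, hx⟩ : ∃ x : k, x ^ 4 ≠ x := by
    classical
    obtain ⟨x, hx⟩ := Infinite.exists_notMem_finset ({0, 1, ω, ω + 1} : Finset k)
    exact ⟨x, fun h ↦ hx (by simpa using (mem_field_iff hω x).mpr h)⟩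
  set S := Algebra.adjoin k ({(X ^ 4 + X) ^ 3} : Set k[X])
  have hC (c : k) : C c ∈ S := S.algebraMap_mem c
  induction hn : p.natDegree using Nat.strong_induction_on generalizing p with
  | _ n ih =>
    set c := ((X ^ 4 + X) ^ 3 : k[X]).eval x
    obtain ⟨q, hq⟩ : (X ^ 4 + X) ^ 3 - C c ∣ p - C (p.eval x) := dvd_sub_C_eval hω hx hp
    have hM0 : (X ^ 4 + X) ^ 3 - C c ≠ 0 := (monic_invariant_sub_C c).ne_zero
    have hpq : p = ((X ^ 4 + X) ^ 3 - C c) * q + C (p.eval x) := by rw [← hq, sub_add_cancel]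
    have hfix (a : k) (σ : k[X] ≃ₐ[k] k[X]) : σ (C a) = C a := σ.commutes a
    have hqfix : ∀ σ ∈ affineGroup k, σ q = q := fun σ hσ ↦ by
      have h := congrArg σ hq
      rw [map_mul, map_sub, map_sub, map_invariant hσ, hp σ hσ, hfix, hfix, hq] at h
      exact (mul_left_cancel₀ hM0 h).symm
    have hqS : q ∈ S := by
      rcases eq_or_ne q 0 with rfl | hq0
      · exact S.zero_mem
      · refine ih q.natDegree ?_ hqfix rfl
        have h := congrArg natDegree hq
        rw [natDegree_sub_C, natDegree_mul hM0 hq0, natDegree_invariant_sub_C] at h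
        omega
    rw [hpq]
    exact S.add_mem (S.mul_mem
      (S.sub_mem (Algebra.subset_adjoin (Set.mem_singleton _)) (hC c)) hqS) (hC _)

theorem map_eq_of_mem_adjoin {p : k[X]}
    (hp : p ∈ Algebra.adjoin k ({(X ^ 4 + X) ^ 3} : Set k[X]))
    {σ : k[X] ≃ₐ[k] k[X]} (hσ : σ ∈ affineGroup k) : σ p = p := by
  have h : Algebra.adjoin k ({(X ^ 4 + X) ^ 3} : Set k[X]) ≤
      AlgHom.equalizer (σ : k[X] →ₐ[k] k[X]) (AlgHom.id k k[X]) :=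
    Algebra.adjoin_le (Set.singleton_subset_iff.mpr (map_invariant hσ))
  exact h hp

end CharTwoAffine

/-- The twelve substitutions `λ ↦ αλ + β` with `α ∈ F₄ \ {0}`, `β ∈ F₄`
form a group `Γ_C` of order 12 of `k`-algebra automorphisms of the polynomial ring `k[λ]`
(char k = 2, ω a primitive cube root of unity, F₄ = {0,1,ω,ω+1}), and the ring of
`Γ_C`-invariants equals the polynomial subring `k[J_C]` with `J_C = (λ⁴+λ)³`. -/
theorem moduli_invariants_C (k : Type*) [Field k] [IsAlgClosed k] [CharP k 2]
    (ω : k) (hω : ω ^ 2 + ω + 1 = 0) :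
    ∃ Γ : Subgroup (Polynomial k ≃ₐ[k] Polynomial k),
      (Γ : Set (Polynomial k ≃ₐ[k] Polynomial k)) =
        {σ : Polynomial k ≃ₐ[k] Polynomial k |
          ∃ α β : k, α ∈ ({1, ω, ω + 1} : Set k) ∧ β ∈ ({0, 1, ω, ω + 1} : Set k) ∧
            σ Polynomial.X = Polynomial.C α * Polynomial.X + Polynomial.C β} ∧
      Nat.card Γ = 12 ∧
      {p : Polynomial k | ∀ σ ∈ Γ, σ p = p} =
        ↑(Algebra.adjoin k
          ({(Polynomial.X ^ 4 + Polynomial.X) ^ 3} : Set (Polynomial k))) := by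
  refine ⟨CharTwoAffine.affineGroup k, ?_, CharTwoAffine.card_affineGroup hω, ?_⟩
  · ext σ
    simp only [SetLike.mem_coe, CharTwoAffine.mem_affineGroup, Set.mem_ofPred_eq,
      CharTwoAffine.mem_units_iff hω, CharTwoAffine.mem_field_iff hω]
  · ext p
    exact ⟨CharTwoAffine.mem_adjoin_of_forall_map_eq hω,
      fun hp _ hσ ↦ CharTwoAffine.map_eq_of_mem_adjoin hp hσ⟩
end

section
/- For every λ ∈ k with λ ∉ {0, 1, ω, ω̄}, the set Z(dGB[λ]) of common zeros in P²(k) of the three partial derivatives ∂GB[λ]/∂X, ∂GB[λ]/∂Y, ∂GB[λ]/∂Z is exactly the 21-point set Z_B(λ). -/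
open MvPolynomial

/-- The conic `Q_λ = (ω̄λ+ω)X² + ω̄Y² + ωλZ² + (λ+1)XY + (ω̄λ+ω)YZ + (λ+1)ZX`. -/
noncomputable def Qlam (k : Type*) [CommRing k] (ω l : k) : MvPolynomial (Fin 3) k :=
  C ((ω + 1) * l + ω) * X 0 ^ 2 + C (ω + 1) * X 1 ^ 2 + C (ω * l) * X 2 ^ 2 +
    C (l + 1) * (X 0 * X 1) + C ((ω + 1) * l + ω) * (X 1 * X 2) + C (l + 1) * (X 2 * X 0)

/-- The sextic polynomial `GB[λ] = XYZ(X+Y+Z)·Q_λ`. -/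
noncomputable def GB (k : Type*) [CommRing k] (ω l : k) : MvPolynomial (Fin 3) k :=
  X 0 * X 1 * X 2 * (X 0 + X 1 + X 2) * Qlam k ω l

/-- The 21 coordinate vectors of the points of `Z_B(λ)` (ω̄ = ω + 1). -/
def ZBvec (k : Type*) [CommRing k] (ω l : k) : Set (Fin 3 → k) :=
  {![l + 1, (ω + 1) * l + ω, (ω + 1) * l + ω],
   ![1, ω * l + ω, ω],
   ![l + ω + 1, 1, l + 1],
   ![1, ω, ω],
   ![l, (ω + 1) * l, (ω + 1) * l + ω + 1],
   ![l + ω + 1, (ω + 1) * l + ω + 1, (ω + 1) * l],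
   ![1, ω + 1, ω + 1],
   ![l + 1, 1, l],
   ![1, ω + 1, ω],
   ![1, ω * l + 1, 0],
   ![1, ω + 1, 0],
   ![1, 1, 0],
   ![l, 0, l + ω + 1],
   ![1, 0, ω],
   ![1, 0, 1],
   ![1, 0, 0],
   ![0, l, 1],
   ![0, 1, ω],
   ![0, 1, 1],
   ![0, 1, 0],
   ![0, 0, 1]}

/-- The 21-point set `Z_B(λ)` in the projective plane `P²(k)`. -/
def ZBpts (k : Type*) [Field k] (ω l : k) : Set (Projectivization k (Fin 3 → k)) :=
  {P | ∃ v ∈ ZBvec k ω l, ∃ hv : v ≠ 0, P = Projectivization.mk k v hv}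


/-- Two vectors of `k³` are parallel when all their `2 × 2` minors vanish. -/
def Parallel {k : Type*} [CommRing k] (v w : Fin 3 → k) : Prop :=
  v 0 * w 1 = v 1 * w 0 ∧ v 0 * w 2 = v 2 * w 0 ∧ v 1 * w 2 = v 2 * w 1

theorem Parallel.exists_smul {k : Type*} [Field k] {v w : Fin 3 → k} (hw : w ≠ 0)
    (h : Parallel v w) : ∃ c : k, c • w = v := by
  obtain ⟨h01, h02, h12⟩ := h
  obtain ⟨i, hi⟩ := Function.ne_iff.1 hw
  refine ⟨v i / w i, funext fun j => ?_⟩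
  simp only [Pi.smul_apply, smul_eq_mul, Pi.zero_apply] at hi ⊢
  field_simp
  fin_cases i <;> fin_cases j <;> simp_all <;> grind

theorem mk_eq_mk_iff_parallel {k : Type*} [Field k] {v w : Fin 3 → k} (hv : v ≠ 0) (hw : w ≠ 0) :
    Projectivization.mk k v hv = Projectivization.mk k w hw ↔ Parallel v w := by
  rw [Projectivization.mk_eq_mk_iff']
  refine ⟨?_, Parallel.exists_smul hw⟩
  rintro ⟨c, rfl⟩
  simp only [Parallel, Pi.smul_apply, smul_eq_mul]
  exact ⟨by ring, by ring, by ring⟩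

theorem eval_pderiv_zero_GB {k : Type*} [CommRing k] [CharP k 2] (ω l : k) (v : Fin 3 → k) :
    eval v (pderiv 0 (GB k ω l)) = v 1 * v 2 * ((v 1 + v 2) *
      ((ω * l + ω + 1) * v 0 ^ 2 + (ω + 1) * v 1 ^ 2 + ((ω + 1) * l + ω) * v 1 * v 2
        + ω * l * v 2 ^ 2)) := by
  simp [GB, Qlam, pderiv_X]
  grind

theorem eval_pderiv_one_GB {k : Type*} [CommRing k] [CharP k 2] (ω l : k) (v : Fin 3 → k) :
    eval v (pderiv 1 (GB k ω l)) = v 0 * v 2 * (((ω + 1) * l + ω) * v 0 ^ 3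
      + (ω * l + ω + 1) * v 0 ^ 2 * v 2 + ((ω + 1) * l + 1) * v 0 * v 2 ^ 2 + ω * l * v 2 ^ 3
      + v 1 ^ 2 * ((l + ω) * v 0 + ((ω + 1) * l + 1) * v 2)) := by
  simp [GB, Qlam, pderiv_X]
  grind

theorem eval_pderiv_two_GB {k : Type*} [CommRing k] [CharP k 2] (ω l : k) (v : Fin 3 → k) :
    eval v (pderiv 2 (GB k ω l)) = v 0 * v 1 * (((ω + 1) * l + ω) * v 0 ^ 3
      + (ω * l + ω + 1) * v 0 ^ 2 * v 1 + (l + ω) * v 0 * v 1 ^ 2 + (ω + 1) * v 1 ^ 3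
      + v 2 ^ 2 * (((ω + 1) * l + 1) * v 0 + (l + ω) * v 1)) := by
  simp [GB, Qlam, pderiv_X]
  grind

theorem forall_eval_pderiv_GB_of_mem {k : Type*} [CommRing k] [CharP k 2] {ω : k}
    (hω : ω ^ 2 + ω + 1 = 0) {l : k} {w : Fin 3 → k} (hw : w ∈ ZBvec k ω l) (c : k) (i : Fin 3) :
    eval (c • w) (pderiv i (GB k ω l)) = 0 := by
  rw [ZBvec] at hw
  fin_cases i
  · simp only [Fin.zero_eta, eval_pderiv_zero_GB]
    rcases hw with rfl | rfl | rfl | rfl | rfl | rfl | rfl | rfl | rfl | rfl | rfl | rfl | rfl |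
      rfl | rfl | rfl | rfl | rfl | rfl | rfl | rfl <;>
    simp <;> grind
  · simp only [Fin.mk_one, eval_pderiv_one_GB]
    rcases hw with rfl | rfl | rfl | rfl | rfl | rfl | rfl | rfl | rfl | rfl | rfl | rfl | rfl |
      rfl | rfl | rfl | rfl | rfl | rfl | rfl | rfl <;>
    simp <;> grind
  · simp only [Fin.reduceFinMk, eval_pderiv_two_GB]
    rcases hw with rfl | rfl | rfl | rfl | rfl | rfl | rfl | rfl | rfl | rfl | rfl | rfl | rfl |
      rfl | rfl | rfl | rfl | rfl | rfl | rfl | rfl <;>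
    simp <;> grind

theorem ne_zero_of_mem_ZBvec {k : Type*} [Field k] [CharP k 2] {ω : k}
    (hω : ω ^ 2 + ω + 1 = 0) {l : k} {w : Fin 3 → k} (hw : w ∈ ZBvec k ω l) : w ≠ 0 := by
  rintro rfl
  simp [ZBvec, funext_iff, Fin.forall_fin_succ] at hw
  grind

theorem eq_or_of_gradient_off_axes {k : Type*} [Field k] [CharP k 2]
    {ω : k} (hω : ω ^ 2 + ω + 1 = 0) {l u : k} (hu : u * (l ^ 4 + l) = 1) {x y z : k}
    (hz : z ≠ 0) 
    (h1 : (y + z) *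
      ((ω * l + ω + 1) * x ^ 2 + (ω + 1) * y ^ 2 + ((ω + 1) * l + ω) * y * z
        + ω * l * z ^ 2) = 0)
    (h2 : ((ω + 1) * l + ω) * x ^ 3 + (ω * l + ω + 1) * x ^ 2 * z + ((ω + 1) * l + 1) * x * z ^ 2 + ω * l * z ^ 3 + y ^ 2 * ((l + ω) * x + ((ω + 1) * l + 1) * z) = 0) : 
   y = z ∧ (x = ω * z ∨ x = (ω + 1) * z ∨ ((ω + 1) * l + ω) * x = (l + 1) * z) ∨
   y = ω * z ∧ x = (ω + 1) * z ∨
   y = (l + 1) * z ∧ x = (ω + 1) * z ∨ 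
   z = (l + 1) * y ∧ x = (l + ω + 1) * y ∨
   (l + 1) * y = l * z ∧ (l + 1) * x = ω * l * z ∨
   l * y = (l + 1) * z ∧ l * x = ω * (l + ω + 1) * z ∨
   z = l * y ∧ x = (l + 1) * y := by
  rcases mul_eq_zero.1 h1 with h | h
  · obtain rfl : y = z := by grind
    have : (x + ω * y) * ((x + (ω + 1) * y) * (((ω + 1) * l + ω) * x + (l + 1) * y)) = 0 := by
      grind
    simp only [mul_eq_zero] at this
    grind
  · have hN : (ω * l + ω + 1) * x ^ 2 = (ω + 1) * y ^ 2 + ((ω + 1) * l + ω) * y * z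
        + ω * l * z ^ 2 := by grind
    have hxU : x * (((ω + 1) * l + ω) * ((ω + 1) * y ^ 2 + ((ω + 1) * l + ω) * y * z
        + ω * l * z ^ 2) + (ω * l + ω + 1) * ((l + ω) * y ^ 2 + ((ω + 1) * l + 1) * z ^ 2)) =
        (ω * l + ω + 1) * (((ω + 1) * l + ω) * (y * z * (y + z))) := by
      grind
    have hR : (y + ω * z) * ((y + (l + 1) * z) * ((z + (l + 1) * y) * (((l + 1) * y + l * z) *
        ((l * y + (l + 1) * z) * (z + l * y))))) = 0 := by
      generalize hNN : (ω + 1) * y ^ 2 + ((ω + 1) * l + ω) * y * z + ω * l * z ^ 2 = N at hN hxU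
      generalize hUU : ((ω + 1) * l + ω) * N
        + (ω * l + ω + 1) * ((l + ω) * y ^ 2 + ((ω + 1) * l + 1) * z ^ 2) = U at hxU
      have hNU : N * U ^ 2 = (ω * l + ω + 1) *
          ((ω * l + ω + 1) * (((ω + 1) * l + ω) * (y * z * (y + z)))) ^ 2 := by
        rw [← hN, ← hxU]; ring
      subst hUU hNN
      clear hN hxU h h1 h2 hu
      grind
    simp only [mul_eq_zero] at hR
    have sq {t : k} (h : t ^ 2 = 0) : t = 0 := by simpa using h
    rcases hR with h | h | h | h | h | h
    · have := @sq (x + (ω + 1) * z) (by grind)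
      grind
    · have := @sq (x + (ω + 1) * z) (by grind)
      grind
    · have := @sq (x + (l + ω + 1) * y) (by grind)
      grind
    · have := @sq ((l + 1) * x + ω * l * z) (by grind)
      grind
    · have := @sq (l * x + ω * (l + ω + 1) * z) (by grind)
      grind
    · have := @sq (x + (l + 1) * y) (by grind)
      grind

set_option maxHeartbeats 2000000 in
theorem exists_mem_ZBvec_parallel {k : Type*} [Field k] [CharP k 2] {ω : k}
    (hω : ω ^ 2 + ω + 1 = 0) {l u : k} (hu : u * (l ^ 4 + l) = 1) {v : Fin 3 → k}
    (h : ∀ i, eval v (pderiv i (GB k ω l)) = 0) : ∃ w ∈ ZBvec k ω l, Parallel v w := by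
  have hx := h 0
  have hy := h 1
  have hz := h 2
  rw [eval_pderiv_zero_GB] at hx
  rw [eval_pderiv_one_GB] at hy
  rw [eval_pderiv_two_GB] at hz
  clear h
  suffices ∃ w ∈ ZBvec k ω l, Parallel ![v 0, v 1, v 2] w by simpa [Parallel] using this
  generalize v 0 = x, v 1 = y, v 2 = z at *
  have witness (w : Fin 3 → k) (hw : w ∈ ZBvec k ω l)
      (h01 : x * w 1 = y * w 0) (h02 : x * w 2 = z * w 0) (h12 : y * w 2 = z * w 1) :
      ∃ w ∈ ZBvec k ω l, Parallel ![x, y, z] w := ⟨w, hw, h01, h02, h12⟩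
  by_cases x0 : x = 0
  · have : y * (z * ((y + z) * ((y + l * z) * (y + (ω + 1) * z)))) = 0 := by grind
    simp only [mul_eq_zero] at this
    rcases this with h | h | h | h | h
    · apply witness ![0, 0, 1] <;> simp [ZBvec] <;> grind
    · apply witness ![0, 1, 0] <;> simp [ZBvec] <;> grind
    · apply witness ![0, 1, 1] <;> simp [ZBvec] <;> grind
    · apply witness ![0, l, 1] <;> simp [ZBvec] <;> grind
    · apply witness ![0, 1, ω] <;> simp [ZBvec] <;> grind
  by_cases y0 : y = 0
  · have : z * ((x + z) * ((x + (ω + 1) * z) * ((l + ω + 1) * x + l * z))) = 0 := by grind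
    simp only [mul_eq_zero] at this
    rcases this with h | h | h | h
    · apply witness ![1, 0, 0] <;> simp [ZBvec] <;> grind
    · apply witness ![1, 0, 1] <;> simp [ZBvec] <;> grind
    · apply witness ![1, 0, ω] <;> simp [ZBvec] <;> grind
    · apply witness ![l, 0, l + ω + 1] <;> simp [ZBvec] <;> grind
  by_cases z0 : z = 0
  · have : (x + y) * ((y + (ω + 1) * x) * (y + (ω * l + 1) * x)) = 0 := by grind
    simp only [mul_eq_zero] at this
    rcases this with h | h | h
    · apply witness ![1, 1, 0] <;> simp [ZBvec] <;> grind
    · apply witness ![1, ω + 1, 0] <;> simp [ZBvec] <;> grind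
    · apply witness ![1, ω * l + 1, 0] <;> simp [ZBvec] <;> grind
  have E1 := (mul_eq_zero.1 hx).resolve_left (mul_ne_zero y0 z0)
  have E2 := (mul_eq_zero.1 hy).resolve_left (mul_ne_zero x0 z0)
  clear hx hy hz
  rcases eq_or_of_gradient_off_axes hω hu z0 E1 E2 with ⟨h, h' | h' | h'⟩ | ⟨h, h'⟩ | ⟨h, h'⟩ | ⟨h, h'⟩ | ⟨h, h'⟩ |
    ⟨h, h'⟩ | ⟨h, h'⟩ <;> clear E1 E2
  · apply witness ![1, ω + 1, ω + 1] <;> simp [ZBvec] <;> grind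
  · apply witness ![1, ω, ω] <;> simp [ZBvec] <;> grind
  · apply witness ![l + 1, (ω + 1) * l + ω, (ω + 1) * l + ω] <;> simp [ZBvec] <;> grind
  · apply witness ![1, ω + 1, ω] <;> simp [ZBvec] <;> grind
  · apply witness ![1, ω * l + ω, ω] <;> simp [ZBvec] <;> grind
  · apply witness ![l + ω + 1, 1, l + 1] <;> simp [ZBvec] <;> grind
  · apply witness ![l, (ω + 1) * l, (ω + 1) * l + ω + 1] <;> simp [ZBvec] <;> grind
  · apply witness ![l + ω + 1, (ω + 1) * l + ω + 1, (ω + 1) * l] <;> simp [ZBvec] <;> grind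
  · apply witness ![l + 1, 1, l] <;> simp [ZBvec] <;> grind

/-- The elements of `ZBvec` as a list. -/
def ZBlist {k : Type*} [CommRing k] (ω l : k) : List (Fin 3 → k) :=
  [![l + 1, (ω + 1) * l + ω, (ω + 1) * l + ω],
   ![1, ω * l + ω, ω],
   ![l + ω + 1, 1, l + 1],
   ![1, ω, ω],
   ![l, (ω + 1) * l, (ω + 1) * l + ω + 1],
   ![l + ω + 1, (ω + 1) * l + ω + 1, (ω + 1) * l],
   ![1, ω + 1, ω + 1],
   ![l + 1, 1, l],
   ![1, ω + 1, ω],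
   ![1, ω * l + 1, 0],
   ![1, ω + 1, 0],
   ![1, 1, 0],
   ![l, 0, l + ω + 1],
   ![1, 0, ω],
   ![1, 0, 1],
   ![1, 0, 0],
   ![0, l, 1],
   ![0, 1, ω],
   ![0, 1, 1],
   ![0, 1, 0],
   ![0, 0, 1]]

theorem mem_ZBlist {k : Type*} [CommRing k] {ω l : k} {v : Fin 3 → k} :
    v ∈ ZBlist ω l ↔ v ∈ ZBvec k ω l := by
  simp only [ZBlist, ZBvec, List.mem_cons, List.not_mem_nil, or_false, Set.mem_insert_iff,
    Set.mem_singleton_iff]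

set_option maxHeartbeats 8000000 in
theorem pairwise_not_parallel_ZBlist {k : Type*} [Field k] [CharP k 2] {ω : k}
    (hω : ω ^ 2 + ω + 1 = 0) {l u : k} (hu : u * (l ^ 4 + l) = 1) :
    (ZBlist ω l).Pairwise (fun v w => ¬ Parallel v w) := by
  simp only [ZBlist, Parallel, List.pairwise_cons, List.forall_mem_cons, List.not_mem_nil,
    IsEmpty.forall_iff, implies_true, and_true, List.Pairwise.nil]
  simp only [Matrix.cons_val_zero, Matrix.cons_val_one, Matrix.cons_val]
  repeat' apply And.intro
  all_goals grind

theorem Parallel.symm {k : Type*} [CommRing k] {v w : Fin 3 → k} (h : Parallel v w) :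
    Parallel w v := by
  unfold Parallel at *
  grind

theorem ncard_ZBpts {k : Type*} [Field k] [CharP k 2] {ω : k}
    (hω : ω ^ 2 + ω + 1 = 0) {l u : k} (hu : u * (l ^ 4 + l) = 1) :
    (ZBpts k ω l).ncard = 21 := by
  classical
  have hpw := pairwise_not_parallel_ZBlist hω hu
  have hnodup : (ZBlist ω l).Nodup := hpw.imp fun h e => h (by simp [e, Parallel, mul_comm])
  have hset : ZBvec k ω l = ((ZBlist ω l).toFinset : Set (Fin 3 → k)) := by
    ext v
    simp [mem_ZBlist]
  have hcard : (ZBvec k ω l).ncard = 21 := by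
    rw [hset, Set.ncard_coe_finset, List.toFinset_card_of_nodup hnodup]
    rfl
  rw [← hcard]
  symm
  refine Set.ncard_congr (fun v hv => Projectivization.mk k v (ne_zero_of_mem_ZBvec hω hv))
    (fun v hv => ⟨v, hv, ne_zero_of_mem_ZBvec hω hv, rfl⟩) (fun v w hv hw h => ?_) ?_
  · by_contra hne
    have : Std.Symm fun v w : Fin 3 → k => ¬ Parallel v w := ⟨fun _ _ h h' => h h'.symm⟩
    exact hpw.forall (mem_ZBlist.2 hv) (mem_ZBlist.2 hw) hne
      ((mk_eq_mk_iff_parallel _ _).1 h)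
  · rintro _ ⟨v, hv, hv0, rfl⟩
    exact ⟨v, hv, rfl⟩

/-- for `λ ∉ {0,1,ω,ω̄}`, the common zero set in `P²(k)` of the three partial
derivatives of `GB[λ]` is exactly the 21-point set `Z_B(λ)`. -/
theorem zero_set_dGB (k : Type*) [Field k] [IsAlgClosed k] [CharP k 2]
    (ω : k) (hω : ω ^ 2 + ω + 1 = 0) (l : k)
    (h0 : l ≠ 0) (h1 : l ≠ 1) (h2 : l ≠ ω) (h3 : l ≠ ω + 1) :
    {P : Projectivization k (Fin 3 → k) |
        ∀ i : Fin 3, eval P.rep (pderiv i (GB k ω l)) = 0} = ZBpts k ω l ∧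
      (ZBpts k ω l).ncard = 21 := by
  have hl : l ^ 4 + l ≠ 0 := by
    have : l * ((l - 1) * ((l - ω) * (l - (ω + 1)))) ≠ 0 :=
      mul_ne_zero h0 (mul_ne_zero (sub_ne_zero.2 h1)
        (mul_ne_zero (sub_ne_zero.2 h2) (sub_ne_zero.2 h3)))
    grind
  have hu : (l ^ 4 + l)⁻¹ * (l ^ 4 + l) = 1 := inv_mul_cancel₀ hl
  refine ⟨?_, ncard_ZBpts hω hu⟩
  ext P
  constructor
  · intro hP
    obtain ⟨w, hw, hPw⟩ := exists_mem_ZBvec_parallel hω hu hP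
    refine ⟨w, hw, ne_zero_of_mem_ZBvec hω hw, ?_⟩
    rw [← (mk_eq_mk_iff_parallel P.rep_nonzero _).2 hPw, Projectivization.mk_rep]
  · rintro ⟨w, hw, hw0, rfl⟩ i
    obtain ⟨c, hc⟩ := Projectivization.exists_smul_eq_mk_rep k w hw0
    rw [← hc]
    exact forall_eval_pderiv_GB_of_mem hω hw (c : k) i
end

section
/- For every α ∈ k with α ∉ {0, 1, ω, ω̄}, the stabilizer subgroup {g ∈ PGL(3,k) : g(Z_A(α)) = Z_A(α)} of the 21-point set Z_A(α) under the natural action of PGL(3,k) on P²(k) is equal to the image in PGL(3,k) of the set of matrices with rows (a₁₁, a₁₂, a), (a₂₁, a₂₂, b), (0, 0, 1), where a₁₁, a₁₂, a₂₁, a₂₂ ∈ {0,1} satisfy a₁₁a₂₂ + a₁₂a₂₁ = 1 and a, b ∈ {0, 1, α, α+1}; in particular this stabilizer has order 96. -/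
/-- The natural action of an invertible matrix `g ∈ GL(3,k)` on the projective plane
`P²(k)`. -/
noncomputable def actGL (k : Type*) [Field k] (g : Matrix.GeneralLinearGroup (Fin 3) k) :
    Projectivization k (Fin 3 → k) → Projectivization k (Fin 3 → k) := fun P =>
  Projectivization.mk k ((g : Matrix (Fin 3) (Fin 3) k).mulVec P.rep) (by
    intro h
    apply P.rep_nonzero
    have h2 : ((g⁻¹ : Matrix.GeneralLinearGroup (Fin 3) k) : Matrix (Fin 3) (Fin 3) k).mulVec
        (((g : Matrix (Fin 3) (Fin 3) k)).mulVec P.rep) = P.rep := by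
      rw [Matrix.mulVec_mulVec, g.inv_mul, Matrix.one_mulVec]
    rw [h, Matrix.mulVec_zero] at h2
    exact h2.symm)

/-- `PGL(3,k)`: the quotient of `GL(3,k)` by its center (the nonzero scalar matrices). -/
abbrev PGL3 (k : Type*) [Field k] : Type _ :=
  Matrix.GeneralLinearGroup (Fin 3) k ⧸ Subgroup.center (Matrix.GeneralLinearGroup (Fin 3) k)

/-- The 21 coordinate vectors of the points of `Z_A(λ)`. -/
def ZAvec (k : Type*) [CommRing k] (ω l : k) : Set (Fin 3 → k) :=
  {![1, ω, 0], ![1, ω + 1, 0], ![l + 1, l + 1, 1], ![l + 1, l, 1], ![l, l, 1],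
   ![l, l + 1, 1], ![l + 1, 1, 1], ![1, l + 1, 1], ![1, 1, 1], ![0, l, 1],
   ![0, 1, 1], ![0, 1, 0], ![1, 1, 0], ![l, 1, 1], ![1, l, 1],
   ![0, l + 1, 1], ![l, 0, 1], ![1, 0, 0], ![1, 0, 1], ![0, 0, 1], ![l + 1, 0, 1]}

/-- The 21-point set `Z_A(λ)` in the projective plane `P²(k)`. -/
def ZApts (k : Type*) [Field k] (ω l : k) : Set (Projectivization k (Fin 3 → k)) :=
  {P | ∃ v ∈ ZAvec k ω l, ∃ hv : v ≠ 0, P = Projectivization.mk k v hv}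

/-- The stabilizer of a subset `Z ⊆ P²(k)` in `PGL(3,k)`: the elements of `PGL(3,k)` all of
whose lifts to `GL(3,k)` map `Z` onto itself. -/
def PGLstab (k : Type*) [Field k] (Z : Set (Projectivization k (Fin 3 → k))) : Set (PGL3 k) :=
  {x | ∀ g : Matrix.GeneralLinearGroup (Fin 3) k, QuotientGroup.mk g = x → actGL k g '' Z = Z}

section SpanOneAlpha

theorem mul_mem_span_one_alpha {k : Type*} [Field k] {α c x : k} (hc : c ∈ ({0, 1} : Set k))
    (hx : x ∈ ({0, 1, α, α + 1} : Set k)) : c * x ∈ ({0, 1, α, α + 1} : Set k) := by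
  rcases hc with rfl | rfl <;> simp_all

variable {k : Type*} [Field k] [CharP k 2] {ω α x y : k}

theorem add_mem_span_one_alpha (hx : x ∈ ({0, 1, α, α + 1} : Set k))
    (hy : y ∈ ({0, 1, α, α + 1} : Set k)) : x + y ∈ ({0, 1, α, α + 1} : Set k) := by
  have h2 : (2 : k) = 0 := CharTwo.two_eq_zero
  simp only [Set.mem_insert_iff, Set.mem_singleton_iff] at *
  rcases hx with rfl | rfl | rfl | rfl <;> rcases hy with rfl | rfl | rfl | rfl <;> grind

/-- Three distinct nonzero elements of a Klein four-group sum to zero. -/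
theorem sum_eq_zero_of_mem_span_one_alpha {z : k} (hx : x ∈ ({0, 1, α, α + 1} : Set k))
    (hy : y ∈ ({0, 1, α, α + 1} : Set k)) (hz : z ∈ ({0, 1, α, α + 1} : Set k))
    (hx0 : x ≠ 0) (hy0 : y ≠ 0) (hz0 : z ≠ 0) (hxy : x ≠ y) (hxz : x ≠ z) (hyz : y ≠ z) :
    x + y + z = 0 := by
  have h2 : (2 : k) = 0 := CharTwo.two_eq_zero
  simp only [Set.mem_insert_iff, Set.mem_singleton_iff] at *
  rcases hx with rfl | rfl | rfl | rfl <;> rcases hy with rfl | rfl | rfl | rfl <;>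
    first
    | contradiction
    | (rcases hz with rfl | rfl | rfl | rfl <;> first | contradiction | grind)

theorem mem_zero_one_of_mul_alpha_mem (hω : ω ^ 2 + ω + 1 = 0)
    (h0 : α ≠ 0) (h1 : α ≠ 1) (h2 : α ≠ ω) (h3 : α ≠ ω + 1)
    (hx : x ∈ ({0, 1, α, α + 1} : Set k)) (hy : α * x ∈ ({0, 1, α, α + 1} : Set k)) :
    x ∈ ({0, 1} : Set k) := by
  have two : (2 : k) = 0 := CharTwo.two_eq_zero
  have key : α ^ 2 + α + 1 ≠ 0 := fun h => by
    have : (α - ω) * (α - (ω + 1)) = 0 := by grind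
    rcases mul_eq_zero.1 this with h | h <;> grind
  have key1 : α + 1 ≠ 0 := fun h => by grind
  have key2 : α * α + 1 ≠ 0 := fun h => key1 (by
    have : (α + 1) ^ 2 = 0 := by grind
    exact pow_eq_zero_iff two_ne_zero |>.1 this)
  simp only [Set.mem_insert_iff, Set.mem_singleton_iff] at *
  rcases hx with rfl | rfl | rfl | rfl <;> grind

theorem eq_zero_of_mul_omega_mem (hω : ω ^ 2 + ω + 1 = 0)
    (h2 : α ≠ ω) (h3 : α ≠ ω + 1)
    (hx : x ∈ ({0, 1, α, α + 1} : Set k)) (hy : ω * x ∈ ({0, 1, α, α + 1} : Set k)) :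
    x = 0 := by
  have two : (2 : k) = 0 := CharTwo.two_eq_zero
  simp only [Set.mem_insert_iff, Set.mem_singleton_iff] at *
  rcases hx with rfl | rfl | rfl | rfl <;> grind

/-- A cross-ratio obstruction: five points of a projective line that are equivalent to `P¹(F₄)`
cannot all lie in `{∞, 0, 1, α, α + 1}` when two of them are distinct affine points. -/
theorem eq_of_cross_ratio_mem (hω : ω ^ 2 + ω + 1 = 0)
    (h2 : α ≠ ω) (h3 : α ≠ ω + 1) {P Q t : k} (ht : t ≠ 0)
    (hP : P ∈ ({0, 1, α, α + 1} : Set k)) (hQ : Q ∈ ({0, 1, α, α + 1} : Set k))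
    (h : ∀ s ∈ ({1, ω, ω + 1} : Set k), 1 + s * t ≠ 0 →
      (P + s * t * Q) / (1 + s * t) ∈ ({0, 1, α, α + 1} : Set k)) : P = Q := by
  have two : (2 : k) = 0 := CharTwo.two_eq_zero
  have hd := add_mem_span_one_alpha hP hQ
  have hm : ∀ s ∈ ({1, ω, ω + 1} : Set k), 1 + s * t ≠ 0 →
      s * t / (1 + s * t) * (P + Q) ∈ ({0, 1, α, α + 1} : Set k) := fun s hs hst => by
    convert add_mem_span_one_alpha hP (h s hs hst) using 1
    field_simp
    grind
  by_contra hPQ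
  have hd0 : P + Q ≠ 0 := fun h => hPQ (by grind)
  have hω0 : ω ≠ 0 := by rintro rfl; simp at hω
  have hω1 : ω + 1 ≠ 0 := fun h => by grind
  have no1 : ω * (P + Q) ∉ ({0, 1, α, α + 1} : Set k) := fun h' =>
    hd0 (eq_zero_of_mul_omega_mem hω h2 h3 hd h')
  have no2 : (ω + 1) * (P + Q) ∉ ({0, 1, α, α + 1} : Set k) := fun h' => no1 (by
    convert add_mem_span_one_alpha h' hd using 1
    grind)
  have a1 : 1 + 1 * t ≠ 0 := fun e => by
    obtain rfl : t = 1 := by grind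
    have hne : 1 + ω * 1 ≠ 0 := by grind
    refine no2 ?_
    convert hm ω (by simp) hne using 2
    field_simp
    grind
  have a2 : 1 + ω * t ≠ 0 := fun e => by
    obtain rfl : t = ω + 1 := by
      have : ω * (t - (ω + 1)) = 0 := by grind
      rcases mul_eq_zero.1 this with h | h <;> grind
    have hne : 1 + 1 * (ω + 1) ≠ 0 := by grind
    refine no1 ?_
    convert hm 1 (by simp) hne using 2
    field_simp
    grind
  have a3 : 1 + (ω + 1) * t ≠ 0 := fun e => by
    obtain rfl : t = ω := by
      have : (ω + 1) * (t - ω) = 0 := by grind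
      rcases mul_eq_zero.1 this with h | h <;> grind
    have hne : 1 + 1 * t ≠ 0 := by grind
    refine no2 ?_
    convert hm 1 (by simp) hne using 2
    field_simp
    grind
  have b1 := hm 1 (by simp) a1
  have b2 := hm ω (by simp) a2
  have b3 := hm (ω + 1) (by simp) a3
  have nz : ∀ s, s ≠ 0 → 1 + s * t ≠ 0 → s * t / (1 + s * t) * (P + Q) ≠ 0 := fun s hs hst =>
    mul_ne_zero (div_ne_zero (mul_ne_zero hs ht) hst) hd0
  have ne1 : ∀ s, 1 + s * t ≠ 0 → P + Q ≠ s * t / (1 + s * t) * (P + Q) := fun s hst e => by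
    have e' : s * t / (1 + s * t) = 1 := mul_right_cancel₀ hd0 (by rw [← e, one_mul])
    rw [div_eq_one_iff_eq hst] at e'
    simp at e'
  have ne2 : ∀ s s', 1 + s * t ≠ 0 → 1 + s' * t ≠ 0 → s ≠ s' →
      s * t / (1 + s * t) * (P + Q) ≠ s' * t / (1 + s' * t) * (P + Q) := fun s s' hs hs' hss e => by
    have e' := mul_right_cancel₀ hd0 e
    rw [div_eq_div_iff hs hs'] at e'
    exact hss (mul_right_cancel₀ ht (by linear_combination e'))
  have n12 : (1 : k) ≠ ω := fun h => by grind
  have n13 : (1 : k) ≠ ω + 1 := fun h => by grind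
  have n23 : ω ≠ ω + 1 := fun h => by grind
  have s1 := sum_eq_zero_of_mem_span_one_alpha hd b1 b2 hd0 (nz _ one_ne_zero a1) (nz _ hω0 a2)
    (ne1 _ a1) (ne1 _ a2) (ne2 _ _ a1 a2 n12)
  have s2 := sum_eq_zero_of_mem_span_one_alpha hd b1 b3 hd0 (nz _ one_ne_zero a1) (nz _ hω1 a3)
    (ne1 _ a1) (ne1 _ a3) (ne2 _ _ a1 a3 n13)
  exact ne2 _ _ a2 a3 n23 (add_left_cancel (s1.trans s2.symm))

end SpanOneAlpha

section ZACondition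

open Matrix

/-- A nonzero vector satisfies `ZACond α` iff it represents a point of `Z_A(α)`. The quintic
cuts out the five points of the line at infinity defined over `F₄`. -/
def ZACond {k : Type*} [Field k] (α : k) (v : Fin 3 → k) : Prop :=
  (v 2 = 0 ∧ v 0 ^ 4 * v 1 + v 0 * v 1 ^ 4 = 0) ∨
    (v 2 ≠ 0 ∧ v 0 / v 2 ∈ ({0, 1, α, α + 1} : Set k) ∧ v 1 / v 2 ∈ ({0, 1, α, α + 1} : Set k))

variable {k : Type*} [Field k]

theorem ZACond.smul {α c : k} {v : Fin 3 → k} (h : ZACond α v) (hc : c ≠ 0) :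
    ZACond α (c • v) := by
  rcases h with ⟨h, h'⟩ | ⟨h, h', h''⟩
  · left
    simp only [Pi.smul_apply, smul_eq_mul, h, mul_zero, true_and]
    linear_combination c ^ 5 * h'
  · right
    simp only [Pi.smul_apply, smul_eq_mul, mul_div_mul_left _ _ hc]
    exact ⟨mul_ne_zero hc h, h', h''⟩

theorem zaCond_of_mem_ZAvec [CharP k 2] {ω α : k} (hω : ω ^ 2 + ω + 1 = 0) {v : Fin 3 → k}
    (hv : v ∈ ZAvec k ω α) : ZACond α v := by
  have two : (2 : k) = 0 := CharTwo.two_eq_zero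
  have e1 : ω + ω ^ 4 = 0 := by linear_combination (ω ^ 2 - ω) * hω + ω * two
  have e2 : (ω + 1) + (ω + 1) ^ 4 = 0 := by grind
  have e3 : (1 : k) + 1 = 0 := by grind
  simp only [ZAvec, Set.mem_insert_iff, Set.mem_singleton_iff] at hv
  rcases hv with rfl | rfl | rfl | rfl | rfl | rfl | rfl | rfl | rfl | rfl | rfl | rfl | rfl |
    rfl | rfl | rfl | rfl | rfl | rfl | rfl | rfl <;> simp [ZACond, e1, e2, e3]

theorem exists_smul_mem_ZAvec [CharP k 2] {ω α : k} (hω : ω ^ 2 + ω + 1 = 0) {v : Fin 3 → k}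
    (h : ZACond α v) : ∃ c : k, ∃ w ∈ ZAvec k ω α, c • w = v := by
  have two : (2 : k) = 0 := CharTwo.two_eq_zero
  rcases h with ⟨h, h'⟩ | ⟨h, h', h''⟩
  · by_cases h0 : v 0 = 0
    · refine ⟨v 1, ![0, 1, 0], by simp [ZAvec], ?_⟩
      ext i; fin_cases i <;> simp [h, h0]
    · refine ⟨v 0, ![1, v 1 / v 0, 0], ?_, ?_⟩
      · have key : v 1 / v 0 = 0 ∨ v 1 / v 0 = 1 ∨ v 1 / v 0 = ω ∨ v 1 / v 0 = ω + 1 := by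
          have : v 1 / v 0 * ((v 1 / v 0 - 1) * ((v 1 / v 0 - ω) * (v 1 / v 0 - (ω + 1)))) = 0 := by
            have hq : v 1 / v 0 + (v 1 / v 0) ^ 4 = 0 := by
              field_simp
              have : v 0 * (v 1 * (v 0 ^ 3 + v 1 ^ 3)) = 0 := by linear_combination h'
              simpa using (mul_eq_zero.1 this).resolve_left h0
            grind
          simpa [sub_eq_zero] using this
        rcases key with e | e | e | e <;> rw [e] <;>
          simp only [ZAvec, Set.mem_insert_iff, Set.mem_singleton_iff, true_or, or_true]
      · ext i; fin_cases i <;> simp [h, mul_div_cancel₀, h0]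
  · refine ⟨v 2, ![v 0 / v 2, v 1 / v 2, 1], ?_, ?_⟩
    · simp only [Set.mem_insert_iff, Set.mem_singleton_iff] at h' h''
      rcases h' with e | e | e | e <;> rcases h'' with e' | e' | e' | e' <;>
        rw [e, e'] <;>
        simp only [ZAvec, Set.mem_insert_iff, Set.mem_singleton_iff, true_or, or_true]
    · ext i; fin_cases i <;> simp [mul_div_cancel₀, h]

theorem mk_mem_ZApts_iff [CharP k 2] {ω α : k} (hω : ω ^ 2 + ω + 1 = 0) {v : Fin 3 → k}
    (hv : v ≠ 0) : Projectivization.mk k v hv ∈ ZApts k ω α ↔ ZACond α v := by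
  constructor
  · rintro ⟨w, hw, hw0, e⟩
    obtain ⟨a, rfl⟩ := (Projectivization.mk_eq_mk_iff k _ _ _ _).1 e
    exact (zaCond_of_mem_ZAvec hω hw).smul a.ne_zero
  · intro h
    obtain ⟨c, w, hw, e⟩ := exists_smul_mem_ZAvec hω h
    have hw0 : w ≠ 0 := by rintro rfl; exact hv (by rw [← e, smul_zero])
    exact ⟨w, hw, hw0, (Projectivization.mk_eq_mk_iff' k _ _ _ _).2 ⟨c, e⟩⟩

theorem GL_mulVec_ne_zero (g : GL (Fin 3) k) {v : Fin 3 → k} (hv : v ≠ 0) :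
    (g : Matrix (Fin 3) (Fin 3) k) *ᵥ v ≠ 0 := fun h => hv (by
  have e : (((g⁻¹ : GL (Fin 3) k)) : Matrix (Fin 3) (Fin 3) k) *ᵥ
      ((g : Matrix (Fin 3) (Fin 3) k) *ᵥ v) = v := by
    rw [mulVec_mulVec, g.inv_mul, one_mulVec]
  rw [← e, h, mulVec_zero])

theorem actGL_mk (g : GL (Fin 3) k) {v : Fin 3 → k} (hv : v ≠ 0) :
    actGL k g (Projectivization.mk k v hv) =
      Projectivization.mk k ((g : Matrix (Fin 3) (Fin 3) k) *ᵥ v) (GL_mulVec_ne_zero g hv) := by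
  obtain ⟨a, ha⟩ := Projectivization.exists_smul_eq_mk_rep k v hv
  refine (Projectivization.mk_eq_mk_iff k _ _ _ _).2 ⟨a, ?_⟩
  rw [← ha, Units.smul_def, Units.smul_def, mulVec_smul]

theorem actGL_injective (g : GL (Fin 3) k) : Function.Injective (actGL k g) := by
  intro P Q
  induction P using Projectivization.ind with | h v hv
  induction Q using Projectivization.ind with | h w hw
  rw [actGL_mk, actGL_mk, Projectivization.mk_eq_mk_iff', Projectivization.mk_eq_mk_iff']
  rintro ⟨a, ha⟩
  refine ⟨a, ?_⟩
  by_contra hne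
  refine GL_mulVec_ne_zero g (sub_ne_zero.2 hne) ?_
  rw [mulVec_sub, mulVec_smul, ha, sub_self]

theorem ZApts_finite (ω α : k) : (ZApts k ω α).Finite := by
  have hf : (ZAvec k ω α).Finite := by
    simp only [ZAvec, Set.finite_insert, Set.finite_singleton]
  refine (hf.biUnion (t := fun v => {P | ∃ hv : v ≠ 0, P = Projectivization.mk k v hv})
    fun v _ => Set.Subsingleton.finite ?_).subset ?_
  · rintro _ ⟨_, rfl⟩ _ ⟨_, rfl⟩
    rfl
  · rintro P ⟨v, hv, h⟩
    exact Set.mem_biUnion hv h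

theorem actGL_image_ZApts_eq_iff [CharP k 2] {ω α : k} (hω : ω ^ 2 + ω + 1 = 0)
    (g : GL (Fin 3) k) : actGL k g '' ZApts k ω α = ZApts k ω α ↔
      ∀ v ≠ 0, ZACond α v → ZACond α ((g : Matrix (Fin 3) (Fin 3) k) *ᵥ v) := by
  constructor
  · intro h v hv hc
    rw [← mk_mem_ZApts_iff hω (GL_mulVec_ne_zero g hv), ← actGL_mk g hv, ← h]
    exact Set.mem_image_of_mem _ ((mk_mem_ZApts_iff hω hv).2 hc)
  · intro h
    refine Set.eq_of_subset_of_ncard_le ?_ ?_ (ZApts_finite ω α)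
    · rintro _ ⟨P, hP, rfl⟩
      induction P using Projectivization.ind with | h v hv
      rw [actGL_mk, mk_mem_ZApts_iff hω]
      exact h v hv ((mk_mem_ZApts_iff hω hv).1 hP)
    · rw [Set.ncard_image_of_injective _ (actGL_injective g)]

theorem exists_smul_eq_of_mk_eq_mk {g h : GL (Fin 3) k}
    (e : (QuotientGroup.mk g : PGL3 k) = QuotientGroup.mk h) :
    ∃ c : k, (h : Matrix (Fin 3) (Fin 3) k) = c • (g : Matrix (Fin 3) (Fin 3) k) := by
  obtain ⟨c, hc⟩ := GeneralLinearGroup.mem_center_iff_val_mem_range_scalar.1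
    (QuotientGroup.eq.1 e)
  refine ⟨c, ?_⟩
  rw [smul_eq_mul_diagonal]
  have : h = g * (g⁻¹ * h) := by group
  rw [this, Units.val_mul, ← hc]
  rfl

theorem actGL_eq_of_mk_eq {g h : GL (Fin 3) k} (e : (QuotientGroup.mk g : PGL3 k) =
    QuotientGroup.mk h) : actGL k g = actGL k h := by
  obtain ⟨c, hgh⟩ := exists_smul_eq_of_mk_eq_mk e
  funext P
  induction P using Projectivization.ind with | h v hv
  rw [actGL_mk, actGL_mk, eq_comm, Projectivization.mk_eq_mk_iff']
  exact ⟨c, by rw [hgh, smul_mulVec]⟩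

theorem mk_mem_PGLstab_iff {Z : Set (Projectivization k (Fin 3 → k))} (g : GL (Fin 3) k) :
    (QuotientGroup.mk g : PGL3 k) ∈ PGLstab k Z ↔ actGL k g '' Z = Z :=
  ⟨fun h => h g rfl, fun h g' e => by rw [actGL_eq_of_mk_eq e, h]⟩

/-- Binary affine matrices preserve the cone over `Z_A(α)`. -/
theorem zaCond_affine_mulVec [CharP k 2] {α a11 a12 a21 a22 a b : k}
    (h11 : a11 ∈ ({0, 1} : Set k)) (h12 : a12 ∈ ({0, 1} : Set k))
    (h21 : a21 ∈ ({0, 1} : Set k)) (h22 : a22 ∈ ({0, 1} : Set k))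
    (ha : a ∈ ({0, 1, α, α + 1} : Set k)) (hb : b ∈ ({0, 1, α, α + 1} : Set k))
    {v : Fin 3 → k} (hv : ZACond α v) :
    ZACond α (!![a11, a12, a; a21, a22, b; 0, 0, 1] *ᵥ v) := by
  have two : (2 : k) = 0 := CharTwo.two_eq_zero
  have e0 : (!![a11, a12, a; a21, a22, b; 0, 0, 1] *ᵥ v) 0 = a11 * v 0 + a12 * v 1 + a * v 2 := by
    simp [mulVec, dotProduct, Fin.sum_univ_three]
  have e1 : (!![a11, a12, a; a21, a22, b; 0, 0, 1] *ᵥ v) 1 = a21 * v 0 + a22 * v 1 + b * v 2 := by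
    simp [mulVec, dotProduct, Fin.sum_univ_three]
  have e2 : (!![a11, a12, a; a21, a22, b; 0, 0, 1] *ᵥ v) 2 = v 2 := by
    simp [mulVec, dotProduct, Fin.sum_univ_three]
  rw [ZACond, e0, e1, e2]
  rcases hv with ⟨h, h'⟩ | ⟨h, h', h''⟩
  · left
    refine ⟨h, ?_⟩
    simp only [h, mul_zero, add_zero]
    rcases h11 with rfl | rfl <;> rcases h12 with rfl | rfl <;> rcases h21 with rfl | rfl <;>
      rcases h22 with rfl | rfl <;> grind
  · right
    refine ⟨h, ?_, ?_⟩
    · convert add_mem_span_one_alpha (add_mem_span_one_alpha (mul_mem_span_one_alpha h11 h')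
        (mul_mem_span_one_alpha h12 h'')) ha using 1
      field_simp
    · convert add_mem_span_one_alpha (add_mem_span_one_alpha (mul_mem_span_one_alpha h21 h')
        (mul_mem_span_one_alpha h22 h'')) hb using 1
      field_simp

/-- If the points `p + s q` with `s ∈ P¹(F₄)` all lie in `Z_A(α)`, then `p` and `q` are
proportional or both lie on the line at infinity. -/
theorem third_coord_eq_zero_of_zaCond [CharP k 2] {ω α : k} (hω : ω ^ 2 + ω + 1 = 0)
    (h2 : α ≠ ω) (h3 : α ≠ ω + 1) {p q : Fin 3 → k} (hpq : LinearIndependent k ![p, q])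
    (hp : ZACond α p) (hq : ZACond α q)
    (h : ∀ s ∈ ({1, ω, ω + 1} : Set k), ZACond α (p + s • q)) : p 2 = 0 ∧ q 2 = 0 := by
  have two : (2 : k) = 0 := CharTwo.two_eq_zero
  have hω0 : ω ≠ 0 := by rintro rfl; simp at hω
  have hω1 : ω + 1 ≠ 0 := fun h => by grind
  rw [LinearIndependent.pair_iff] at hpq
  have hp0 : p ≠ 0 := fun h => by simpa using hpq 1 0 (by simp [h])
  have hq0 : q ≠ 0 := fun h => by simpa using hpq 0 1 (by simp [h])
  by_cases p2 : p 2 = 0 <;> by_cases q2 : q 2 = 0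
  · exact ⟨p2, q2⟩
  · exfalso
    apply hp0
    have hq' := (hq.resolve_left fun h => q2 h.1).2
    have a1 := ((h 1 (by simp)).resolve_left fun h => q2 (by simpa [p2] using h.1)).2
    have a2 := ((h (ω + 1) (by simp)).resolve_left fun h => q2 (by simpa [p2, hω1] using h.1)).2
    simp only [Pi.add_apply, Pi.smul_apply, smul_eq_mul, p2, zero_add, one_mul] at a1 a2
    have key : ∀ i, (p i + q i) / q 2 ∈ ({0, 1, α, α + 1} : Set k) →
        (p i + (ω + 1) * q i) / ((ω + 1) * q 2) ∈ ({0, 1, α, α + 1} : Set k) →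
        q i / q 2 ∈ ({0, 1, α, α + 1} : Set k) → p i = 0 := fun i b1 b2 b3 => by
      have c1 : p i / q 2 ∈ ({0, 1, α, α + 1} : Set k) := by
        convert add_mem_span_one_alpha b1 b3 using 1
        field_simp
        grind
      have c2 : ω * (p i / q 2) ∈ ({0, 1, α, α + 1} : Set k) := by
        convert add_mem_span_one_alpha b2 b3 using 1
        field_simp
        grind
      simpa [q2] using eq_zero_of_mul_omega_mem hω h2 h3 c1 c2
    ext i
    fin_cases i
    · exact key 0 a1.1 a2.1 hq'.1
    · exact key 1 a1.2 a2.2 hq'.2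
    · exact p2
  · exfalso
    apply hq0
    have hp' := (hp.resolve_left fun h => p2 h.1).2
    have a1 := ((h 1 (by simp)).resolve_left fun h => p2 (by simpa [q2] using h.1)).2
    have a2 := ((h ω (by simp)).resolve_left fun h => p2 (by simpa [q2] using h.1)).2
    simp only [Pi.add_apply, Pi.smul_apply, smul_eq_mul, q2, mul_zero, add_zero, one_mul] at a1 a2
    have key : ∀ i, (p i + q i) / p 2 ∈ ({0, 1, α, α + 1} : Set k) →
        (p i + ω * q i) / p 2 ∈ ({0, 1, α, α + 1} : Set k) →
        p i / p 2 ∈ ({0, 1, α, α + 1} : Set k) → q i = 0 := fun i b1 b2 b3 => by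
      have c1 : q i / p 2 ∈ ({0, 1, α, α + 1} : Set k) := by
        convert add_mem_span_one_alpha b1 b3 using 1
        field_simp
        grind
      have c2 : ω * (q i / p 2) ∈ ({0, 1, α, α + 1} : Set k) := by
        convert add_mem_span_one_alpha b2 b3 using 1
        field_simp
        grind
      simpa [p2] using eq_zero_of_mul_omega_mem hω h2 h3 c1 c2
    ext i
    fin_cases i
    · exact key 0 a1.1 a2.1 hp'.1
    · exact key 1 a1.2 a2.2 hp'.2
    · exact q2
  · exfalso
    have hp' := (hp.resolve_left fun h => p2 h.1).2
    have hq' := (hq.resolve_left fun h => q2 h.1).2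
    have hs : ∀ s ∈ ({1, ω, ω + 1} : Set k), 1 + s * (q 2 / p 2) ≠ 0 →
        (p 0 + s * q 0) / (p 2 + s * q 2) ∈ ({0, 1, α, α + 1} : Set k) ∧
        (p 1 + s * q 1) / (p 2 + s * q 2) ∈ ({0, 1, α, α + 1} : Set k) := fun s hs hne =>
      ((h s hs).resolve_left fun h => hne (by
        have := h.1
        simp only [Pi.add_apply, Pi.smul_apply, smul_eq_mul] at this
        field_simp
        simpa using this)).2
    have key : ∀ i, p i / p 2 ∈ ({0, 1, α, α + 1} : Set k) →
        q i / q 2 ∈ ({0, 1, α, α + 1} : Set k) →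
        (∀ s ∈ ({1, ω, ω + 1} : Set k), 1 + s * (q 2 / p 2) ≠ 0 →
          (p i + s * q i) / (p 2 + s * q 2) ∈ ({0, 1, α, α + 1} : Set k)) →
        p i / p 2 = q i / q 2 := fun i b1 b2 b3 => by
      refine eq_of_cross_ratio_mem hω h2 h3 (div_ne_zero q2 p2) b1 b2 fun s hs hne => ?_
      convert b3 s hs hne using 1
      have : p 2 + s * q 2 ≠ 0 := fun h => hne (by field_simp; simpa using h)
      field_simp
    have k0 := key 0 hp'.1 hq'.1 fun s h h' => (hs s h h').1
    have k1 := key 1 hp'.2 hq'.2 fun s h h' => (hs s h h').2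
    refine q2 (hpq (q 2) (- p 2) ?_).1
    rw [div_eq_div_iff p2 q2] at k0 k1
    ext i
    fin_cases i
    · simp; linear_combination k0
    · simp; linear_combination k1
    · simp; ring

theorem exists_affine_of_zaCond_mulVec [CharP k 2] {ω α : k} (hω : ω ^ 2 + ω + 1 = 0)
    (h0 : α ≠ 0) (h1 : α ≠ 1) (h2 : α ≠ ω) (h3 : α ≠ ω + 1) (g : GL (Fin 3) k)
    (h : ∀ v ≠ 0, ZACond α v → ZACond α ((g : Matrix (Fin 3) (Fin 3) k) *ᵥ v)) :
    ∃ a11 a12 a21 a22 a b c : k,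
      a11 ∈ ({0, 1} : Set k) ∧ a12 ∈ ({0, 1} : Set k) ∧
      a21 ∈ ({0, 1} : Set k) ∧ a22 ∈ ({0, 1} : Set k) ∧
      a11 * a22 + a12 * a21 = 1 ∧
      a ∈ ({0, 1, α, α + 1} : Set k) ∧ b ∈ ({0, 1, α, α + 1} : Set k) ∧
      (g : Matrix (Fin 3) (Fin 3) k) = c • !![a11, a12, a; a21, a22, b; 0, 0, 1] := by
  have two : (2 : k) = 0 := CharTwo.two_eq_zero
  set M : Matrix (Fin 3) (Fin 3) k := g.val
  have hmul : ∀ x y z i, (M *ᵥ ![x, y, z]) i = M i 0 * x + M i 1 * y + M i 2 * z :=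
      fun x y z i => by
    simp [mulVec, dotProduct, Fin.sum_univ_three]
  have hinf : ∀ s, s + s ^ 4 = 0 → ZACond α (M *ᵥ ![1, s, 0]) := fun s hs =>
    h _ (fun e => by simpa using congrFun e 0) (Or.inl (by simpa using hs))
  have hind : LinearIndependent k ![M *ᵥ ![1, 0, 0], M *ᵥ ![0, 1, 0]] := by
    rw [LinearIndependent.pair_iff]
    intro s t e
    have e' : M *ᵥ ![s, t, 0] = 0 := by
      rw [← e]
      ext i
      simp only [Pi.add_apply, Pi.smul_apply, smul_eq_mul, hmul]
      ring
    by_contra hst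
    refine GL_mulVec_ne_zero g (fun e'' => hst ⟨?_, ?_⟩) e'
    · simpa using congrFun e'' 0
    · simpa using congrFun e'' 1
  have hcols := third_coord_eq_zero_of_zaCond hω h2 h3 hind (hinf 0 (by simp))
    (h _ (fun e => by simpa using congrFun e 1) (Or.inl (by simp))) (fun s hs => by
      have : M *ᵥ ![1, 0, 0] + s • M *ᵥ ![0, 1, 0] = M *ᵥ ![1, s, 0] := by
        ext i
        simp only [Pi.add_apply, Pi.smul_apply, smul_eq_mul, hmul]
        ring
      rw [this]
      apply hinf
      simp only [Set.mem_insert_iff, Set.mem_singleton_iff] at hs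
      rcases hs with rfl | rfl | rfl <;> grind)
  have m20 : M 2 0 = 0 := by simpa [hmul] using hcols.1
  have m21 : M 2 1 = 0 := by simpa [hmul] using hcols.2
  have hdet : M.det ≠ 0 := ((Matrix.isUnit_iff_isUnit_det _).1 g.isUnit).ne_zero
  rw [det_fin_three, m20, m21] at hdet
  have m22 : M 2 2 ≠ 0 := fun e => hdet (by rw [e]; ring)
  have haff : ∀ x ∈ ({0, 1, α, α + 1} : Set k), ∀ y ∈ ({0, 1, α, α + 1} : Set k),
      (M 0 0 * x + M 0 1 * y + M 0 2) / M 2 2 ∈ ({0, 1, α, α + 1} : Set k) ∧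
      (M 1 0 * x + M 1 1 * y + M 1 2) / M 2 2 ∈ ({0, 1, α, α + 1} : Set k) := fun x hx y hy => by
    have := h ![x, y, 1] (fun e => by simpa using congrFun e 2)
      (Or.inr (by simpa [-Set.mem_insert_iff] using ⟨hx, hy⟩))
    simpa [ZACond, hmul, m20, m21, m22, -Set.mem_insert_iff] using this
  have z : (0 : k) ∈ ({0, 1, α, α + 1} : Set k) := by simp
  have o : (1 : k) ∈ ({0, 1, α, α + 1} : Set k) := by simp
  have l : α ∈ ({0, 1, α, α + 1} : Set k) := by simp
  have htr := haff 0 z 0 z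
  simp only [mul_zero, zero_add] at htr
  have key : ∀ u w : k, w / M 2 2 ∈ ({0, 1, α, α + 1} : Set k) →
      (u + w) / M 2 2 ∈ ({0, 1, α, α + 1} : Set k) →
      (u * α + w) / M 2 2 ∈ ({0, 1, α, α + 1} : Set k) → u / M 2 2 ∈ ({0, 1} : Set k) :=
    fun u w b1 b2 b3 => by
      refine mem_zero_one_of_mul_alpha_mem hω h0 h1 h2 h3 ?_ ?_
      · convert add_mem_span_one_alpha b2 b1 using 1
        field_simp
        grind
      · convert add_mem_span_one_alpha b3 b1 using 1
        field_simp
        grind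
  have hx1 := haff 1 o 0 z
  have hxα := haff α l 0 z
  have hy1 := haff 0 z 1 o
  have hyα := haff 0 z α l
  simp only [mul_zero, zero_add, add_zero, mul_one] at hx1 hxα hy1 hyα
  have k00 := key _ _ htr.1 hx1.1 hxα.1
  have k01 := key _ _ htr.1 hy1.1 hyα.1
  have k10 := key _ _ htr.2 hx1.2 hxα.2
  have k11 := key _ _ htr.2 hy1.2 hyα.2
  refine ⟨M 0 0 / M 2 2, M 0 1 / M 2 2, M 1 0 / M 2 2, M 1 1 / M 2 2, M 0 2 / M 2 2,
    M 1 2 / M 2 2, M 2 2, k00, k01, k10, k11, ?_, htr.1, htr.2, ?_⟩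
  · have hd : M 0 0 / M 2 2 * (M 1 1 / M 2 2) + M 0 1 / M 2 2 * (M 1 0 / M 2 2) ≠ 0 := fun e => by
      field_simp at e
      apply hdet
      linear_combination M 2 2 * e - M 0 1 * M 1 0 * M 2 2 * two
    revert hd
    simp only [Set.mem_insert_iff, Set.mem_singleton_iff] at k00 k01 k10 k11
    rcases k00 with e | e <;> rcases k01 with e' | e' <;> rcases k10 with e'' | e'' <;>
      rcases k11 with e''' | e''' <;> rw [e, e', e'', e'''] <;> intro hd <;> grind
  · ext i j
    fin_cases i <;> fin_cases j <;> simp [m20, m21, mul_div_cancel₀, m22]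

theorem mk_eq_mk_of_eq_smul {g h : GL (Fin 3) k} {c : k}
    (e : (g : Matrix (Fin 3) (Fin 3) k) = c • (h : Matrix (Fin 3) (Fin 3) k)) :
    (QuotientGroup.mk h : PGL3 k) = QuotientGroup.mk g := by
  rw [QuotientGroup.eq, GeneralLinearGroup.mem_center_iff_val_mem_range_scalar]
  refine ⟨c, ?_⟩
  rw [Units.val_mul, e, mul_smul_comm, h.inv_mul, smul_one_eq_diagonal]
  rfl

/-- Parameters over `F₂` for the stabilizer: entries of the linear part, which is invertible, and
coordinates of the translation part with respect to `1, α`. -/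
abbrev AffineParam : Type :=
  {t : (ZMod 2 × ZMod 2 × ZMod 2 × ZMod 2) × (ZMod 2 × ZMod 2 × ZMod 2 × ZMod 2) //
    t.1.1 * t.1.2.2.2 + t.1.2.1 * t.1.2.2.1 = 1}

theorem card_affineParam : Nat.card AffineParam = 96 := by
  rw [Nat.card_eq_fintype_card]
  rfl

variable [CharP k 2]

/-- The affine matrix with the given binary parameters. -/
noncomputable def affineMatrix (α : k) (t : AffineParam) : Matrix (Fin 3) (Fin 3) k :=
  let φ := ZMod.castHom (dvd_refl 2) k
  !![φ t.1.1.1, φ t.1.1.2.1, φ t.1.2.1 + φ t.1.2.2.1 * α;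
    φ t.1.1.2.2.1, φ t.1.1.2.2.2, φ t.1.2.2.2.1 + φ t.1.2.2.2.2 * α; 0, 0, 1]

theorem det_affineMatrix (α : k) (t : AffineParam) : (affineMatrix α t).det = 1 := by
  have two : (2 : k) = 0 := CharTwo.two_eq_zero
  have e := congrArg (ZMod.castHom (dvd_refl 2) k) t.2
  rw [map_add, map_mul, map_mul, map_one] at e
  simp only [affineMatrix, det_fin_three, of_apply, cons_val]
  linear_combination e - ZMod.castHom (dvd_refl 2) k t.1.1.2.1 *
    ZMod.castHom (dvd_refl 2) k t.1.1.2.2.1 * two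

/-- The class in `PGL(3,k)` of `affineMatrix α t`. -/
noncomputable def affinePGL (α : k) (t : AffineParam) : PGL3 k :=
  QuotientGroup.mk (GeneralLinearGroup.mkOfDetNeZero (affineMatrix α t)
    (by rw [det_affineMatrix]; exact one_ne_zero))

theorem affineMatrix_injective {α : k} (h0 : α ≠ 0) (h1 : α ≠ 1) :
    Function.Injective (affineMatrix α) := by
  have two : (2 : k) = 0 := CharTwo.two_eq_zero
  have hφ : Function.Injective (ZMod.castHom (dvd_refl 2) k) := RingHom.injective _
  have hV : ∀ x y x' y' : ZMod 2,
      ZMod.castHom (dvd_refl 2) k x + ZMod.castHom (dvd_refl 2) k y * α =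
      ZMod.castHom (dvd_refl 2) k x' + ZMod.castHom (dvd_refl 2) k y' * α → x = x' ∧ y = y' := by
    intro x y x' y' e
    have hb : ∀ x : ZMod 2, x = 0 ∨ x = 1 := by decide
    rcases hb x with rfl | rfl <;> rcases hb y with rfl | rfl <;> rcases hb x' with rfl | rfl <;>
      rcases hb y' with rfl | rfl <;> simp only [map_zero, map_one] at e <;> grind
  rintro ⟨⟨⟨x1, x2, x3, x4⟩, x5, x6, x7, x8⟩, hx⟩ ⟨⟨⟨y1, y2, y3, y4⟩, y5, y6, y7, y8⟩, hy⟩ e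
  obtain rfl : x1 = y1 := hφ (congrFun (congrFun e 0) 0)
  obtain rfl : x2 = y2 := hφ (congrFun (congrFun e 0) 1)
  obtain rfl : x3 = y3 := hφ (congrFun (congrFun e 1) 0)
  obtain rfl : x4 = y4 := hφ (congrFun (congrFun e 1) 1)
  obtain ⟨rfl, rfl⟩ : x5 = y5 ∧ x6 = y6 := hV _ _ _ _ (congrFun (congrFun e 0) 2)
  obtain ⟨rfl, rfl⟩ : x7 = y7 ∧ x8 = y8 := hV _ _ _ _ (congrFun (congrFun e 1) 2)
  rfl

theorem affinePGL_injective {α : k} (h0 : α ≠ 0) (h1 : α ≠ 1) :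
    Function.Injective (affinePGL α) := by
  intro s t e
  obtain ⟨c, hc⟩ := exists_smul_eq_of_mk_eq_mk e
  change affineMatrix α t = c • affineMatrix α s at hc
  have hc1 : c = 1 := by simpa [affineMatrix] using (congrFun (congrFun hc 2) 2).symm
  rw [hc1, one_smul] at hc
  exact (affineMatrix_injective h0 h1 hc).symm

theorem range_affinePGL (α : k) : Set.range (affinePGL α) =
    {x : PGL3 k | ∃ g : GL (Fin 3) k,
      (∃ a11 a12 a21 a22 a b : k,
        a11 ∈ ({0, 1} : Set k) ∧ a12 ∈ ({0, 1} : Set k) ∧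
        a21 ∈ ({0, 1} : Set k) ∧ a22 ∈ ({0, 1} : Set k) ∧
        a11 * a22 + a12 * a21 = 1 ∧
        a ∈ ({0, 1, α, α + 1} : Set k) ∧ b ∈ ({0, 1, α, α + 1} : Set k) ∧
        (g : Matrix (Fin 3) (Fin 3) k) = !![a11, a12, a; a21, a22, b; 0, 0, 1]) ∧
      QuotientGroup.mk g = x} := by
  have hb : ∀ x : ZMod 2, x = 0 ∨ x = 1 := by decide
  have hF : ∀ x : k, x ∈ ({0, 1} : Set k) ↔ ∃ t, ZMod.castHom (dvd_refl 2) k t = x := fun x => by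
    constructor
    · rintro (rfl | rfl)
      exacts [⟨0, map_zero _⟩, ⟨1, map_one _⟩]
    · rintro ⟨t, rfl⟩
      rcases hb t with rfl | rfl <;> simp only [map_zero, map_one] <;> simp
  have hV : ∀ x : k, x ∈ ({0, 1, α, α + 1} : Set k) ↔ ∃ s t, ZMod.castHom (dvd_refl 2) k s +
      ZMod.castHom (dvd_refl 2) k t * α = x := fun x => by
    constructor
    · rintro (rfl | rfl | rfl | rfl)
      exacts [⟨0, 0, by simp only [map_zero]; ring⟩, ⟨1, 0, by simp only [map_zero, map_one]; ring⟩,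
        ⟨0, 1, by simp only [map_zero, map_one]; ring⟩, ⟨1, 1, by simp only [map_one]; ring⟩]
    · rintro ⟨s, t, rfl⟩
      rcases hb s with rfl | rfl <;> rcases hb t with rfl | rfl <;>
        simp only [map_zero, map_one] <;> simp [add_comm]
  ext x
  constructor
  · rintro ⟨t, rfl⟩
    refine ⟨_, ⟨_, _, _, _, _, _, (hF _).2 ⟨_, rfl⟩, (hF _).2 ⟨_, rfl⟩, (hF _).2 ⟨_, rfl⟩,
      (hF _).2 ⟨_, rfl⟩, ?_, (hV _).2 ⟨_, _, rfl⟩, (hV _).2 ⟨_, _, rfl⟩, rfl⟩, rfl⟩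
    rw [← map_mul, ← map_mul, ← map_add, t.2, map_one]
  · rintro ⟨g, ⟨a11, a12, a21, a22, a, b, h11, h12, h21, h22, hd, ha, hb', hg⟩, rfl⟩
    obtain ⟨t11, rfl⟩ := (hF _).1 h11
    obtain ⟨t12, rfl⟩ := (hF _).1 h12
    obtain ⟨t21, rfl⟩ := (hF _).1 h21
    obtain ⟨t22, rfl⟩ := (hF _).1 h22
    obtain ⟨s, s', rfl⟩ := (hV _).1 ha
    obtain ⟨t, t', rfl⟩ := (hV _).1 hb'
    rw [← map_mul, ← map_mul, ← map_add, ← map_one (ZMod.castHom (dvd_refl 2) k)] at hd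
    refine ⟨⟨((t11, t12, t21, t22), s, s', t, t'), RingHom.injective _ hd⟩, ?_⟩
    exact congrArg _ (Units.ext hg.symm)

end ZACondition

/-- for `α ∉ {0,1,ω,ω̄}`, the stabilizer in `PGL(3,k)` of the 21-point set
`Z_A(α)` is the image in `PGL(3,k)` of the matrices `[[A, (a,b)ᵗ], [(0,0), 1]]` with
`A ∈ GL(2,F₂)` and `a, b ∈ {0, 1, α, α+1}`; in particular it has order 96. -/
theorem stabilizer_ZA (k : Type*) [Field k] [IsAlgClosed k] [CharP k 2]
    (ω : k) (hω : ω ^ 2 + ω + 1 = 0) (α : k)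
    (h0 : α ≠ 0) (h1 : α ≠ 1) (h2 : α ≠ ω) (h3 : α ≠ ω + 1) :
    PGLstab k (ZApts k ω α) =
      {x : PGL3 k | ∃ g : Matrix.GeneralLinearGroup (Fin 3) k,
        (∃ a11 a12 a21 a22 a b : k,
          a11 ∈ ({0, 1} : Set k) ∧ a12 ∈ ({0, 1} : Set k) ∧
          a21 ∈ ({0, 1} : Set k) ∧ a22 ∈ ({0, 1} : Set k) ∧
          a11 * a22 + a12 * a21 = 1 ∧
          a ∈ ({0, 1, α, α + 1} : Set k) ∧ b ∈ ({0, 1, α, α + 1} : Set k) ∧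
          (g : Matrix (Fin 3) (Fin 3) k) = !![a11, a12, a; a21, a22, b; 0, 0, 1]) ∧
        QuotientGroup.mk g = x} ∧
    Nat.card (PGLstab k (ZApts k ω α)) = 96 := by
  have hset := range_affinePGL α
  suffices h : PGLstab k (ZApts k ω α) = Set.range (affinePGL α) by
    refine ⟨h.trans hset, ?_⟩
    rw [h, Nat.card_range_of_injective (affinePGL_injective h0 h1), card_affineParam]
  rw [hset]
  ext x
  induction x using QuotientGroup.induction_on with | H g
  rw [mk_mem_PGLstab_iff, actGL_image_ZApts_eq_iff hω]
  constructor
  · intro h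
    obtain ⟨a11, a12, a21, a22, a, b, c, h11, h12, h21, h22, hd, ha, hb, hg⟩ :=
      exists_affine_of_zaCond_mulVec hω h0 h1 h2 h3 g h
    have hdet : (!![a11, a12, a; a21, a22, b; 0, 0, 1] : Matrix (Fin 3) (Fin 3) k).det ≠ 0 := by
      have : IsUnit (g : Matrix (Fin 3) (Fin 3) k).det :=
        (Matrix.isUnit_iff_isUnit_det _).1 g.isUnit
      rw [hg, Matrix.det_smul] at this
      exact right_ne_zero_of_mul this.ne_zero
    exact ⟨Matrix.GeneralLinearGroup.mkOfDetNeZero _ hdet,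
      ⟨a11, a12, a21, a22, a, b, h11, h12, h21, h22, hd, ha, hb, rfl⟩, mk_eq_mk_of_eq_smul hg⟩
  · rintro ⟨g', ⟨a11, a12, a21, a22, a, b, h11, h12, h21, h22, -, ha, hb, hg⟩, e⟩
    rw [← actGL_image_ZApts_eq_iff hω, ← actGL_eq_of_mk_eq e, actGL_image_ZApts_eq_iff hω, hg]
    exact fun v _ hv => zaCond_affine_mulVec h11 h12 h21 h22 ha hb hv
end
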